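/- Let k ∈ {4,6,8,10,14}, p ∈ {2,3,5}, m, s > 0, d = dim M_k(Γ_0(p)), and ε < 12/(p-1). Write g(τ) = f_{k,m p^s}(τ) - f_{k,m p^{s-1}}(pτ) = Σ_{n≥1} γ_n q^n. If p^ε divides γ_n for all 1 ≤ n ≤ d-1, then p^ε divides γ_n for all n ≥ 1; in particular, for p ∤ n, v_p(a_k(m p^s, n)) ≥ ε. -/

import Mathlib

open UpperHalfPlane Complex CongruenceSubgroup MatrixGroups
open scoped ModularForm Real MatrixGroups Manifold

noncomputable section

/-- `q = e^{2 π i τ}`. -/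
def qexp (τ : UpperHalfPlane) : ℂ := Complex.exp (2 * π * Complex.I * τ)

/-- `f` has the `q`-expansion `∑ c n qⁿ` at `∞`, with only finitely many negative terms. -/
def HasExpansion (f : UpperHalfPlane → ℂ) (c : ℤ → ℂ) : Prop :=
  (∃ N : ℤ, ∀ n : ℤ, n < N → c n = 0) ∧
    ∀ τ : UpperHalfPlane, HasSum (fun n : ℤ => c n * qexp τ ^ n) (f τ)

/-- Weakly holomorphic modular forms of weight `k` on `Γ`, together with their
Fourier coefficients. -/
structure WhmForm (Γ : Subgroup SL(2, ℤ)) (k : ℤ) where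
  toFun : UpperHalfPlane → ℂ
  coeff : ℤ → ℂ
  holo : MDifferentiable 𝓘(ℂ) 𝓘(ℂ) toFun
  slash_eq : ∀ γ ∈ Γ, toFun ∣[k] γ = toFun
  expansion : HasExpansion toFun coeff

/-- `f = q^{-m} + O(q^{ℓ+1})`. -/
def IsBasisElt {Γ : Subgroup SL(2, ℤ)} (k ℓ m : ℤ) (f : WhmForm Γ k) : Prop :=
  f.coeff (-m) = 1 ∧ ∀ n : ℤ, n ≠ -m → n ≤ ℓ → f.coeff n = 0

/-- multiplication of a point of the upper half plane by a positive real number. -/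
def rscale (a : ℝ) (ha : 0 < a) (τ : UpperHalfPlane) : UpperHalfPlane :=
  ⟨a * τ, by simpa [Complex.mul_im] using mul_pos ha τ.2⟩

/-- `τ ↦ -1/τ` on the upper half plane. -/
def neginv (τ : UpperHalfPlane) : UpperHalfPlane :=
  ⟨(-(τ : ℂ))⁻¹, τ.im_inv_neg_coe_pos⟩

/-! ### `q`-series -/

open PowerSeries Filter Topology

lemma qexp_ne_zero (τ : ℍ) : qexp τ ≠ 0 := Complex.exp_ne_zero _

lemma qexp_eq_qParam (τ : ℍ) : qexp τ = Function.Periodic.qParam 1 τ := by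
  simp [qexp, Function.Periodic.qParam]

lemma norm_qexp_lt_one (τ : ℍ) : ‖qexp τ‖ < 1 := by
  rw [qexp_eq_qParam]
  exact Function.Periodic.norm_qParam_lt_one one_pos τ.im_pos

lemma qexp_vadd_one (τ : ℍ) : qexp ((1 : ℝ) +ᵥ τ) = qexp τ := by
  rw [qexp, qexp, UpperHalfPlane.coe_vadd, Complex.exp_eq_exp_iff_exists_int]
  exact ⟨1, by push_cast; ring⟩

lemma qexp_rscale (p : ℕ) (hp : 0 < (p : ℝ)) (τ : ℍ) : qexp (rscale p hp τ) = qexp τ ^ p := by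
  rw [qexp, qexp, ← Complex.exp_nat_mul]
  congr 1
  simp only [rscale, Complex.ofReal_natCast]
  ring

/-- `f = q ^ a * P(q)`, where `P` is a power series that converges on the unit disc. -/
def HasQSeries (f : ℍ → ℂ) (a : ℤ) (P : ℂ⟦X⟧) : Prop :=
  ∀ τ : ℍ, HasSum (fun n : ℕ ↦ coeff n P * qexp τ ^ n) (qexp τ ^ (-a) * f τ)

lemma HasSum.congr_left_right {ι : Type*} {u v : ι → ℂ} {x y : ℂ} (h : HasSum u x)
    (huv : ∀ i, v i = u i) (hxy : y = x) : HasSum v y := by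
  rw [hxy, funext huv]
  exact h

namespace HasQSeries

variable {f g : ℍ → ℂ} {a b : ℤ} {P Q : ℂ⟦X⟧}

lemma const (c : ℂ) : HasQSeries (fun _ ↦ c) 0 (C c) := by
  intro τ
  convert hasSum_single (α := ℂ) 0 _ using 1
  · simp
  · intro n hn
    simp [coeff_C, hn]

lemma smul (c : ℂ) (hf : HasQSeries f a P) : HasQSeries (fun τ ↦ c * f τ) a (C c * P) := by
  intro τ
  exact ((hf τ).mul_left c).congr_left_right (fun n ↦ by simp [mul_assoc]) (by ring)

lemma sub (hf : HasQSeries f a P) (hg : HasQSeries g a Q) :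
    HasQSeries (fun τ ↦ f τ - g τ) a (P - Q) := by
  intro τ
  exact ((hf τ).sub (hg τ)).congr_left_right (fun n ↦ by simp [sub_mul]) (by ring)

lemma sum {ι : Type*} (s : Finset ι) {f : ι → ℍ → ℂ} {P : ι → ℂ⟦X⟧}
    (hf : ∀ i ∈ s, HasQSeries (f i) a (P i)) :
    HasQSeries (fun τ ↦ ∑ i ∈ s, f i τ) a (∑ i ∈ s, P i) := by
  intro τ
  convert hasSum_sum (fun i hi ↦ hf i hi τ) using 1
  · ext n; simp [Finset.sum_mul]
  · rw [Finset.mul_sum]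

lemma mul (hf : HasQSeries f a P) (hg : HasQSeries g b Q) :
    HasQSeries (fun τ ↦ f τ * g τ) (a + b) (P * Q) := by
  intro τ
  have h1 := (hf τ).summable.norm
  have h2 := (hg τ).summable.norm
  have key := tsum_mul_tsum_eq_tsum_sum_antidiagonal_of_summable_norm h1 h2
  have hs := (summable_norm_sum_mul_antidiagonal_of_summable_norm h1 h2).of_norm
  have e : ∀ n : ℕ, ∑ kl ∈ Finset.HasAntidiagonal.antidiagonal n,
      (coeff kl.1 P * qexp τ ^ kl.1) * (coeff kl.2 Q * qexp τ ^ kl.2) =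
      coeff n (P * Q) * qexp τ ^ n := by
    intro n
    rw [coeff_mul, Finset.sum_mul]
    refine Finset.sum_congr rfl fun x hx ↦ ?_
    rw [← Finset.HasAntidiagonal.mem_antidiagonal.mp hx, pow_add]
    ring
  have := hs.hasSum
  rw [← key, (hf τ).tsum_eq, (hg τ).tsum_eq] at this
  simp only [e] at this
  refine this.congr_left_right (fun _ ↦ rfl) ?_
  rw [neg_add, zpow_add₀ (qexp_ne_zero τ)]
  ring

lemma pow (hf : HasQSeries f a P) (n : ℕ) : HasQSeries (fun τ ↦ f τ ^ n) (n * a) (P ^ n) := by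
  induction n with
  | zero => simpa using const 1
  | succ n ih =>
    have := ih.mul hf
    simpa only [pow_succ, Nat.cast_succ, add_mul, one_mul] using this

lemma X_pow_mul (hf : HasQSeries f a P) (n : ℕ) : HasQSeries f (a - n) (X ^ n * P) := by
  have h1 : HasQSeries (fun _ ↦ 1) (-n : ℤ) (X ^ n) := by
    intro τ
    convert hasSum_single (α := ℂ) n _ using 1
    · simp
    · intro m hm
      simp [coeff_X_pow, hm]
  have := h1.mul hf
  simp only [one_mul] at this
  rwa [neg_add_eq_sub] at this

lemma of_X_pow_mul {n : ℕ} (hf : HasQSeries f a (X ^ n * P)) : HasQSeries f (a + n) P := by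
  intro τ
  have h := hf τ
  rw [← hasSum_nat_add_iff' n] at h
  have h0 : ∑ i ∈ Finset.range n, coeff i (X ^ n * P) * qexp τ ^ i = 0 := by
    refine Finset.sum_eq_zero fun i hi ↦ ?_
    rw [coeff_X_pow_mul', if_neg (by simpa using hi), zero_mul]
  rw [h0, sub_zero] at h
  refine (h.mul_left (qexp τ ^ (-n : ℤ))).congr_left_right (fun i ↦ ?_) ?_
  · rw [coeff_X_pow_mul', if_pos (by simp), pow_add, Nat.add_sub_cancel, zpow_neg, zpow_natCast]
    field_simp [qexp_ne_zero τ]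
  · rw [← mul_assoc, ← zpow_add₀ (qexp_ne_zero τ)]
    congr 2
    ring

lemma hasSum_zero (hf : HasQSeries f 0 P) (τ : ℍ) :
    HasSum (fun n : ℕ ↦ coeff n P * qexp τ ^ n) (f τ) := by
  simpa using hf τ

lemma isBoundedAtImInfty (hf : HasQSeries f 0 P) : IsBoundedAtImInfty f := by
  refine isBoundedAtImInfty_of_hasSum_qExpansion one_pos (c := fun n ↦ coeff n P) fun τ ↦ ?_
  simpa [qexp_eq_qParam] using hf τ

lemma of_le (hf : HasQSeries f a P) (h : b ≤ a) : ∃ Q, HasQSeries f b Q := by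
  obtain ⟨n, rfl⟩ := Int.le.dest h
  exact ⟨_, by simpa using hf.X_pow_mul n⟩

lemma isBoundedAtImInfty_of_nonneg (hf : HasQSeries f a P) (ha : 0 ≤ a) :
    IsBoundedAtImInfty f :=
  (hf.of_le ha).choose_spec.isBoundedAtImInfty

lemma vadd_one (hf : HasQSeries f a P) (τ : ℍ) : f ((1 : ℝ) +ᵥ τ) = f τ := by
  have h1 := hf τ
  have h2 := hf ((1 : ℝ) +ᵥ τ)
  rw [qexp_vadd_one] at h2
  exact mul_left_cancel₀ (zpow_ne_zero _ (qexp_ne_zero τ)) (h2.unique h1)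

lemma of_bounded (hper : ∀ τ : ℍ, f ((1 : ℝ) +ᵥ τ) = f τ) (hol : MDifferentiable 𝓘(ℂ) 𝓘(ℂ) f)
    (hb : IsBoundedAtImInfty f) : HasQSeries f 0 (qExpansion 1 f) := by
  have hper' : Function.Periodic (f ∘ ofComplex) ((1 : ℝ) : ℂ) := by
    intro z
    by_cases hz : 0 < z.im
    · have h1 : 0 < (z + (1 : ℝ)).im := by simpa using hz
      simp only [Function.comp_apply]
      rw [ofComplex_apply_of_im_pos hz, ofComplex_apply_of_im_pos h1, ← hper ⟨z, hz⟩]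
      exact congrArg f (UpperHalfPlane.ext (add_comm z _))
    · have h1 : ¬ 0 < (z + (1 : ℝ)).im := by simpa using hz
      simp only [Function.comp_apply]
      rw [ofComplex_apply_of_im_nonpos (not_lt.mp hz), ofComplex_apply_of_im_nonpos (not_lt.mp h1)]
  intro τ
  simpa [qexp_eq_qParam] using UpperHalfPlane.hasSum_qExpansion one_pos hper' hol hb τ

lemma eq_zero (hP : HasQSeries (fun _ ↦ 0) 0 P) : P = 0 := by
  have han : AnalyticAt ℂ (cuspFunction 1 (fun _ : ℍ ↦ (0 : ℂ))) 0 :=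
    analyticAt_cuspFunction_zero one_pos (fun z ↦ by simp) mdifferentiable_const
      hP.isBoundedAtImInfty
  have h1 := hasFPowerSeriesOnBall_cuspFunction (f := fun _ : ℍ ↦ (0 : ℂ))
    (c := fun n ↦ coeff n P) one_pos han fun τ ↦ by simpa [qexp_eq_qParam] using hP τ
  have h2 := hasFPowerSeriesOnBall_cuspFunction (f := fun _ : ℍ ↦ (0 : ℂ))
    (c := fun n ↦ 0) one_pos han fun τ ↦ by simp
  ext n
  simpa using congrArg (FormalMultilinearSeries.coeff · n)
    (h1.hasFPowerSeriesAt.eq_formalMultilinearSeries h2.hasFPowerSeriesAt)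

lemma unique (hP : HasQSeries f a P) (hQ : HasQSeries f a Q) : P = Q := by
  have h : HasQSeries (fun _ ↦ 0) 0 (P - Q) := by
    intro τ
    simpa using (hP.sub hQ) τ
  exact sub_eq_zero.mp h.eq_zero

lemma tendsto (hf : HasQSeries f 0 P) : Tendsto f atImInfty (𝓝 (constantCoeff P)) := by
  have h1 : HasQSeries (fun τ ↦ f τ - constantCoeff P) 0 (P - C (constantCoeff P)) :=
    hf.sub (const _)
  obtain ⟨Q, hQ⟩ : X ^ 1 ∣ P - C (constantCoeff P) := by
    rw [pow_one, X_dvd_iff]; simp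
  rw [hQ] at h1
  have h3 : HasQSeries (fun τ ↦ qexp τ ^ (-1 : ℤ) * (f τ - constantCoeff P)) 0 Q := by
    intro τ
    simpa using h1.of_X_pow_mul τ
  have hq : Tendsto qexp atImInfty (𝓝 0) := by
    have h := (qParam_tendsto_atImInfty (h := 1) one_pos)
    exact h.congr fun τ ↦ (qexp_eq_qParam τ).symm
  have h4 : Tendsto (fun τ ↦ qexp τ * (qexp τ ^ (-1 : ℤ) * (f τ - constantCoeff P))) atImInfty
      (𝓝 0) := by
    refine (Asymptotics.isLittleO_one_iff ℝ).mp ?_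
    simpa using ((Asymptotics.isLittleO_one_iff ℝ).mpr hq).mul_isBigO h3.isBoundedAtImInfty
  have h5 : Tendsto (fun τ ↦ f τ - constantCoeff P) atImInfty (𝓝 0) := by
    refine h4.congr fun τ ↦ ?_
    rw [← mul_assoc, zpow_neg_one, mul_inv_cancel₀ (qexp_ne_zero τ), one_mul]
  simpa using h5.add_const (constantCoeff P)

lemma rscale {p : ℕ} (hp : p ≠ 0) (hp' : 0 < (p : ℝ)) (hf : HasQSeries f a P) :
    HasQSeries (fun τ ↦ f (rscale p hp' τ)) (p * a) (expand p hp P) := by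
  intro τ
  have h := hf (_root_.rscale p hp' τ)
  have hinj : Function.Injective (fun n : ℕ ↦ p * n) := fun x y h ↦ by
    simpa [hp] using h
  rw [← hinj.hasSum_iff]
  · convert h using 1
    · ext n
      simp [coeff_expand_mul, qexp_rscale, pow_mul]
    · rw [qexp_rscale, ← zpow_natCast, ← zpow_mul]
      congr 2
      ring
  · intro n hn
    rw [coeff_expand_of_not_dvd, zero_mul]
    rintro ⟨k, rfl⟩
    exact hn ⟨k, rfl⟩

end HasQSeries

/-! ### Generators of `Γ₀(p)` for `p = 2, 3, 5` -/

lemma Int.exists_two_mul_abs_add_mul_le (c d : ℤ) (hc : c ≠ 0) :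
    ∃ n : ℤ, 2 * |d + c * n| ≤ |c| := by
  have h0 := Int.emod_nonneg d hc
  have h1 := Int.emod_lt_abs d hc
  have h2 := Int.emod_add_mul_ediv d c
  by_cases h : 2 * (d % c) ≤ |c|
  · refine ⟨-(d / c), ?_⟩
    rw [show d + c * -(d / c) = d % c by linarith, abs_of_nonneg h0]
    exact h
  · push Not at h
    refine ⟨-(d / c) - c.sign, ?_⟩
    rw [show d + c * (-(d / c) - c.sign) = d % c - |c| by
      linarith [Int.mul_sign_self c, Int.abs_eq_natAbs c], abs_of_nonpos (by linarith)]
    linarith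

/-- The matrix `(1, 0; p, 1)`. -/
def lowerUnipotent (p : ℤ) : SL(2, ℤ) := ⟨!![1, 0; p, 1], by simp⟩

lemma lowerUnipotent_neg (p : ℤ) : (lowerUnipotent p)⁻¹ = lowerUnipotent (-p) := by
  refine inv_eq_of_mul_eq_one_right (Subtype.ext ?_)
  change !![1, 0; p, 1] * !![1, 0; -p, 1] = (1 : Matrix (Fin 2) (Fin 2) ℤ)
  simp [Matrix.one_fin_two]

/-- The elliptic matrix `(2 * e, -1; 5, -2 * e)` for `e ^ 2 = 1`. -/
def ellipticFive (e : ℤˣ) : SL(2, ℤ) :=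
  ⟨!![2 * e, -1; 5, -(2 * e)], by
    rcases Int.units_eq_one_or e with rfl | rfl <;> simp [Matrix.det_fin_two]⟩

lemma Gamma0_le_of_generators {p : ℕ} (hp : p = 2 ∨ p = 3 ∨ p = 5) (H : Subgroup SL(2, ℤ))
    (hneg : -1 ∈ H) (hT : ModularGroup.T ∈ H) (hV : lowerUnipotent p ∈ H)
    (he : p = 5 → ∀ e : ℤˣ, ellipticFive e ∈ H) : Gamma0 p ≤ H := by
  suffices ∀ (N : ℕ) (g : SL(2, ℤ)), (g 1 0).natAbs ≤ N → (p : ℤ) ∣ g 1 0 → g ∈ H by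
    intro g hg
    refine this _ g le_rfl ?_
    rw [Gamma0_mem] at hg
    exact (ZMod.intCast_zmod_eq_zero_iff_dvd _ _).mp hg
  have hdet : ∀ g : SL(2, ℤ), g 0 0 * g 1 1 - g 0 1 * g 1 0 = 1 := fun g ↦ by
    rw [← Matrix.det_fin_two]; exact g.det_coe
  intro N
  induction N with
  | zero =>
    intro g hg _
    have hc : g 1 0 = 0 := by omega
    have h := hdet g
    rw [hc, mul_zero, sub_zero] at h
    rcases Int.mul_eq_one_iff_eq_one_or_neg_one.mp h with ⟨h1, h2⟩ | ⟨h1, h2⟩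
    · have : g = ModularGroup.T ^ (g 0 1) := by
        ext i j
        rw [ModularGroup.coe_T_zpow]
        fin_cases i <;> fin_cases j <;> simp [h1, h2, hc]
      rw [this]
      exact H.zpow_mem hT _
    · have : g = -1 * ModularGroup.T ^ (-(g 0 1)) := by
        ext i j
        rw [neg_one_mul, Matrix.SpecialLinearGroup.coe_neg, ModularGroup.coe_T_zpow]
        fin_cases i <;> fin_cases j <;> simp [h1, h2, hc]
      rw [this]
      exact H.mul_mem hneg (H.zpow_mem hT _)
  | succ N ih =>
    intro g hg hpg
    by_cases hc : g 1 0 = 0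
    · exact ih g (by omega) hpg
    obtain ⟨n, hn⟩ := Int.exists_two_mul_abs_add_mul_le (g 1 0) (g 1 1) hc
    suffices g * ModularGroup.T ^ n ∈ H from (H.mul_mem_cancel_right (H.zpow_mem hT n)).mp this
    have hcT : (g * ModularGroup.T ^ n) 1 0 = g 1 0 := by
      rw [Matrix.SpecialLinearGroup.coe_mul, ModularGroup.coe_T_zpow]
      simp [Matrix.mul_apply]
    have hdT : (g * ModularGroup.T ^ n) 1 1 = g 1 1 + g 1 0 * n := by
      rw [Matrix.SpecialLinearGroup.coe_mul, ModularGroup.coe_T_zpow]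
      simp [Matrix.mul_apply]; ring
    rw [← hdT, ← hcT] at hn
    rw [← hcT] at hg hpg hc
    generalize g * ModularGroup.T ^ n = g at *
    have hd : g 1 1 ≠ 0 := by
      intro h
      have h1 := hdet g
      rw [h, mul_zero, zero_sub] at h1
      have h2 : (p : ℤ) ∣ 1 := h1 ▸ (hpg.mul_left _).neg_right
      rcases hp with rfl | rfl | rfl <;> revert h2 <;> decide
    have step : ∀ x ∈ H, (p : ℤ) ∣ x 1 0 →
        |g 1 0 * x 0 0 + g 1 1 * x 1 0| < |g 1 0| → g ∈ H := by
      intro x hx hpx hlt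
      have hgx : (g * x) 1 0 = g 1 0 * x 0 0 + g 1 1 * x 1 0 := by
        rw [Matrix.SpecialLinearGroup.coe_mul]
        simp [Matrix.mul_apply]
      refine (H.mul_mem_cancel_right hx).mp (ih (g * x) ?_ ?_)
      · rw [← hgx, Int.abs_eq_natAbs, Int.abs_eq_natAbs] at hlt
        omega
      · rw [hgx]
        exact (hpg.mul_right _).add (hpx.mul_left _)
    have hV1 := step _ hV (by simp [lowerUnipotent])
    have hV2 := step _ (lowerUnipotent_neg p ▸ H.inv_mem hV) (by simp [lowerUnipotent])
    simp only [lowerUnipotent, Matrix.of_apply, Matrix.cons_val', Matrix.cons_val_zero,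
      Matrix.cons_val_one, Matrix.cons_val_fin_one, mul_one] at hV1 hV2
    by_contra hgH
    replace hV1 := not_lt.mp fun h ↦ hgH (hV1 h)
    replace hV2 := not_lt.mp fun h ↦ hgH (hV2 h)
    rcases hp with rfl | rfl | rfl
    · push_cast at hV1 hV2
      grind only [abs, max_def]
    · push_cast at hV1 hV2
      grind only [abs, max_def]
    · have he1 := not_lt.mp fun h ↦ hgH (step _ (he rfl 1) (by simp [ellipticFive]) h)
      have he2 := not_lt.mp fun h ↦ hgH (step _ (he rfl (-1)) (by simp [ellipticFive]) h)
      simp only [ellipticFive, Matrix.of_apply, Matrix.cons_val', Matrix.cons_val_zero,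
        Matrix.cons_val_one, Matrix.cons_val_fin_one, mul_one, Units.val_one,
        Units.val_neg] at he1 he2
      push_cast at hV1 hV2
      grind only [abs, max_def]

/-- A complex power series is unital if it has integer coefficients and constant term `1`. -/
def Unital (P : ℂ⟦X⟧) : Prop :=
  ∃ P₀ : ℤ⟦X⟧, constantCoeff P₀ = 1 ∧ PowerSeries.map (Int.castRingHom ℂ) P₀ = P

namespace Unital

variable {P Q : ℂ⟦X⟧}

lemma one : Unital 1 := ⟨1, by simp, by simp⟩

lemma mul (hP : Unital P) (hQ : Unital Q) : Unital (P * Q) := by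
  obtain ⟨P, hP, rfl⟩ := hP
  obtain ⟨Q, hQ, rfl⟩ := hQ
  exact ⟨P * Q, by simp [hP, hQ], by simp⟩

lemma pow (hP : Unital P) (n : ℕ) : Unital (P ^ n) := by
  induction n with
  | zero => simpa using one
  | succ n ih => simpa only [pow_succ] using ih.mul hP

lemma expand (hP : Unital P) {p : ℕ} (hp : p ≠ 0) : Unital (PowerSeries.expand p hp P) := by
  obtain ⟨P, hP, rfl⟩ := hP
  exact ⟨PowerSeries.expand p hp P, by simp [hP], by rw [map_expand]⟩

lemma exists_mul_eq_one (hP : Unital P) : ∃ Q, Unital Q ∧ P * Q = 1 := by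
  obtain ⟨P, hP, rfl⟩ := hP
  have h : P * invOfUnit P 1 = 1 := mul_invOfUnit P 1 (by simpa using hP)
  refine ⟨PowerSeries.map (Int.castRingHom ℂ) (invOfUnit P 1), ⟨invOfUnit P 1, ?_, rfl⟩, ?_⟩
  · simp
  · rw [← map_mul, h, map_one]

lemma constantCoeff_eq (hP : Unital P) : constantCoeff P = 1 := by
  obtain ⟨P, hP, rfl⟩ := hP
  simp [← coeff_zero_eq_constantCoeff_apply, coeff_map, hP]

lemma coeff_int (hP : Unital P) (n : ℕ) : ∃ z : ℤ, coeff n P = z := by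
  obtain ⟨P, hP, rfl⟩ := hP
  exact ⟨coeff n P, by simp⟩

end Unital

/-- `f = q ^ a * (1 + O(q))` with integer Fourier coefficients. -/
def HasUnitalQSeries (f : ℍ → ℂ) (a : ℤ) : Prop := ∃ P, Unital P ∧ HasQSeries f a P

namespace HasUnitalQSeries

variable {f g : ℍ → ℂ} {a b : ℤ}

lemma mul (hf : HasUnitalQSeries f a) (hg : HasUnitalQSeries g b) :
    HasUnitalQSeries (fun τ ↦ f τ * g τ) (a + b) := by
  obtain ⟨P, hP, hfP⟩ := hf
  obtain ⟨Q, hQ, hgQ⟩ := hg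
  exact ⟨_, hP.mul hQ, hfP.mul hgQ⟩

lemma pow (hf : HasUnitalQSeries f a) (n : ℕ) : HasUnitalQSeries (fun τ ↦ f τ ^ n) (n * a) := by
  obtain ⟨P, hP, hfP⟩ := hf
  exact ⟨_, hP.pow n, hfP.pow n⟩

lemma rscale {p : ℕ} (hp : p ≠ 0) (hp' : 0 < (p : ℝ)) (hf : HasUnitalQSeries f a) :
    HasUnitalQSeries (fun τ ↦ f (rscale p hp' τ)) (p * a) := by
  obtain ⟨P, hP, hfP⟩ := hf
  exact ⟨_, hP.expand hp, hfP.rscale hp hp'⟩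

lemma inv (hf : HasUnitalQSeries f 0) (hol : MDifferentiable 𝓘(ℂ) 𝓘(ℂ) f) (h0 : ∀ τ, f τ ≠ 0) :
    HasUnitalQSeries (fun τ ↦ (f τ)⁻¹) 0 := by
  obtain ⟨P, hP, hfP⟩ := hf
  have ht : Tendsto (fun τ ↦ (f τ)⁻¹) atImInfty (𝓝 1) := by
    simpa [hP.constantCoeff_eq] using hfP.tendsto.inv₀ (by simp [hP.constantCoeff_eq])
  have hol' : MDifferentiable 𝓘(ℂ) 𝓘(ℂ) fun τ ↦ (f τ)⁻¹ := by
    rw [UpperHalfPlane.mdifferentiable_iff] at hol ⊢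
    exact hol.inv fun z _ ↦ h0 _
  have hb : IsBoundedAtImInfty fun τ ↦ (f τ)⁻¹ := ht.isBigO_one ℝ
  have hQ := HasQSeries.of_bounded (fun τ ↦ by rw [hfP.vadd_one]) hol' hb
  obtain ⟨Q, hQu, hPQ⟩ := hP.exists_mul_eq_one
  refine ⟨_, ?_, hQ⟩
  have h1 := (hfP.mul hQ).unique (a := 0) (Q := 1) (by
    simpa [h0] using HasQSeries.const 1)
  have : qExpansion 1 (fun τ ↦ (f τ)⁻¹) = Q := by
    calc _ = Q * (P * qExpansion 1 (fun τ ↦ (f τ)⁻¹)) := by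
            rw [← mul_assoc, mul_comm Q, hPQ, one_mul]
      _ = Q := by rw [h1, mul_one]
  rwa [this]

end HasUnitalQSeries

/-- Multiplication by `p` on the upper half plane. -/
def scale (p : ℕ) [NeZero p] : ℍ → ℍ := rscale p (by exact_mod_cast NeZero.pos p)

/-- The Fricke involution `τ ↦ -1 / (p τ)`. -/
def fricke (p : ℕ) [NeZero p] (τ : ℍ) : ℍ := neginv (scale p τ)

section Fricke

variable {p : ℕ} [NeZero p]

lemma coe_scale (τ : ℍ) : (scale p τ : ℂ) = p * τ := by simp [scale, rscale]

lemma coe_neginv (τ : ℍ) : (neginv τ : ℂ) = (-(τ : ℂ))⁻¹ := rfl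

lemma neginv_eq (τ : ℍ) : neginv τ = ModularGroup.S • τ := by
  rw [UpperHalfPlane.modular_S_smul]; rfl

lemma coe_fricke (τ : ℍ) : (fricke p τ : ℂ) = (-(p * τ : ℂ))⁻¹ := by
  rw [fricke, coe_neginv, coe_scale]

lemma fricke_fricke (τ : ℍ) : fricke p (fricke p τ) = τ := by
  ext
  have := τ.ne_zero
  have hp : (p : ℂ) ≠ 0 := NeZero.ne _
  rw [coe_fricke, coe_fricke]
  field_simp

lemma scale_fricke (τ : ℍ) : scale p (fricke p τ) = neginv τ := by
  ext
  have := τ.ne_zero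
  have hp : (p : ℂ) ≠ 0 := NeZero.ne _
  rw [coe_scale, coe_fricke, coe_neginv]
  field_simp

end Fricke

/-- The stabilizer of `f` under the weight `k` slash action. -/
def slashStabilizer (k : ℤ) (f : ℍ → ℂ) : Subgroup SL(2, ℤ) where
  carrier := {γ | f ∣[k] γ = f}
  mul_mem' := by
    intro a b ha hb
    simp only [Set.mem_ofPred_eq] at *
    rw [SlashAction.slash_mul, ha, hb]
  one_mem' := by simp
  inv_mem' := by
    intro a ha
    simp only [Set.mem_ofPred_eq] at *
    conv_lhs => rw [← ha]
    rw [← SlashAction.slash_mul, mul_inv_cancel, SlashAction.slash_one]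

lemma mem_slashStabilizer {k : ℤ} {f : ℍ → ℂ} {γ : SL(2, ℤ)} :
    γ ∈ slashStabilizer k f ↔ ∀ τ : ℍ, f (γ • τ) = denom γ τ ^ k * f τ := by
  change f ∣[k] γ = f ↔ _
  rw [funext_iff]
  refine forall_congr' fun τ ↦ ?_
  rw [ModularForm.SL_slash_apply, zpow_neg, mul_inv_eq_iff_eq_mul₀
    (zpow_ne_zero _ (denom_ne_zero _ _)), mul_comm]

/-- `f` is a holomorphic function, modular of weight `k` for `Γ₀(p)`, and `g` is its image
under the Fricke involution. -/
structure IsFrickePair (p : ℕ) [NeZero p] (k : ℤ) (f g : ℍ → ℂ) : Prop where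
  holo : MDifferentiable 𝓘(ℂ) 𝓘(ℂ) f
  le_stabilizer : Gamma0 p ≤ slashStabilizer k f
  fricke_eq : ∀ τ : ℍ, f (fricke p τ) = (τ : ℂ) ^ k * g τ

namespace IsFrickePair

variable {p : ℕ} [NeZero p] {k l : ℤ} {f g f' g' : ℍ → ℂ}

lemma one : IsFrickePair p 0 (fun _ ↦ 1) (fun _ ↦ 1) where
  holo := mdifferentiable_const
  le_stabilizer := fun γ _ ↦ mem_slashStabilizer.mpr fun τ ↦ by simp
  fricke_eq τ := by simp

lemma mul (h : IsFrickePair p k f g) (h' : IsFrickePair p l f' g') :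
    IsFrickePair p (k + l) (fun τ ↦ f τ * f' τ) (fun τ ↦ g τ * g' τ) where
  holo := by
    have h1 := h.holo
    have h2 := h'.holo
    rw [UpperHalfPlane.mdifferentiable_iff] at h1 h2 ⊢
    exact h1.mul h2
  le_stabilizer γ hγ := mem_slashStabilizer.mpr fun τ ↦ by
    rw [mem_slashStabilizer.mp (h.le_stabilizer hγ), mem_slashStabilizer.mp (h'.le_stabilizer hγ),
      zpow_add₀ (denom_ne_zero _ _)]
    ring
  fricke_eq τ := by
    rw [h.fricke_eq, h'.fricke_eq, zpow_add₀ τ.ne_zero]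
    ring

lemma pow (h : IsFrickePair p k f g) (n : ℕ) :
    IsFrickePair p (n * k) (fun τ ↦ f τ ^ n) (fun τ ↦ g τ ^ n) := by
  induction n with
  | zero => simpa using one
  | succ n ih => simpa only [pow_succ, Nat.cast_succ, add_mul, one_mul] using ih.mul h

lemma smul (h : IsFrickePair p k f g) (c : ℂ) :
    IsFrickePair p k (fun τ ↦ c * f τ) (fun τ ↦ c * g τ) where
  holo := by
    have h1 := h.holo
    rw [UpperHalfPlane.mdifferentiable_iff] at h1 ⊢
    exact h1.const_mul c
  le_stabilizer γ hγ := mem_slashStabilizer.mpr fun τ ↦ by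
    rw [mem_slashStabilizer.mp (h.le_stabilizer hγ)]; ring
  fricke_eq τ := by rw [h.fricke_eq]; ring

lemma sub (h : IsFrickePair p k f g) (h' : IsFrickePair p k f' g') :
    IsFrickePair p k (fun τ ↦ f τ - f' τ) (fun τ ↦ g τ - g' τ) where
  holo := by
    have h1 := h.holo
    have h2 := h'.holo
    rw [UpperHalfPlane.mdifferentiable_iff] at h1 h2 ⊢
    exact h1.sub h2
  le_stabilizer γ hγ := mem_slashStabilizer.mpr fun τ ↦ by
    rw [mem_slashStabilizer.mp (h.le_stabilizer hγ), mem_slashStabilizer.mp (h'.le_stabilizer hγ)]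
    ring
  fricke_eq τ := by rw [h.fricke_eq, h'.fricke_eq]; ring

lemma sum {ι : Type*} (s : Finset ι) {f g : ι → ℍ → ℂ}
    (h : ∀ i ∈ s, IsFrickePair p k (f i) (g i)) :
    IsFrickePair p k (fun τ ↦ ∑ i ∈ s, f i τ) (fun τ ↦ ∑ i ∈ s, g i τ) where
  holo := by
    have h1 := fun i hi ↦ (UpperHalfPlane.mdifferentiable_iff.mp (h i hi).holo)
    rw [UpperHalfPlane.mdifferentiable_iff]
    exact DifferentiableOn.fun_sum h1
  le_stabilizer γ hγ := mem_slashStabilizer.mpr fun τ ↦ by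
    rw [Finset.mul_sum]
    exact Finset.sum_congr rfl fun i hi ↦ mem_slashStabilizer.mp ((h i hi).le_stabilizer hγ) τ
  fricke_eq τ := by
    rw [Finset.mul_sum]
    exact Finset.sum_congr rfl fun i hi ↦ (h i hi).fricke_eq τ

end IsFrickePair

section ScaleSMul

variable {p : ℕ} [NeZero p]

lemma exists_scale_smul {γ : SL(2, ℤ)} (hγ : γ ∈ Gamma0 p) :
    ∃ γ' : SL(2, ℤ), (p : ℤ) * γ' 1 0 = γ 1 0 ∧ ∀ τ : ℍ, scale p (γ • τ) = γ' • scale p τ ∧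
      denom γ' (scale p τ) = denom γ τ := by
  obtain ⟨c, hc⟩ : (p : ℤ) ∣ γ 1 0 := by
    rw [Gamma0_mem] at hγ
    exact (ZMod.intCast_zmod_eq_zero_iff_dvd _ _).mp hγ
  have hdet := γ.det_coe
  rw [Matrix.det_fin_two, hc] at hdet
  obtain ⟨γ', h⟩ : ∃ γ' : SL(2, ℤ),
      (γ' : Matrix (Fin 2) (Fin 2) ℤ) = !![γ 0 0, p * γ 0 1; c, γ 1 1] :=
    ⟨⟨_, by rw [Matrix.det_fin_two_of]; linear_combination hdet⟩, rfl⟩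
  refine ⟨γ', by simp [h, hc], fun τ ↦ ?_⟩
  · have hd : denom γ' (scale p τ) = denom γ τ := by
      rw [ModularGroup.denom_apply, ModularGroup.denom_apply, h, hc]
      simp [coe_scale]
      ring
    refine ⟨?_, hd⟩
    have h0 := denom_ne_zero γ τ
    ext
    rw [coe_scale, UpperHalfPlane.coe_specialLinearGroup_apply,
      UpperHalfPlane.coe_specialLinearGroup_apply]
    simp [coe_scale, hc, h]
    rw [ModularGroup.denom_apply, hc] at h0
    push_cast at h0
    have h1 : (c : ℂ) * (p * τ) + (γ 1 1 : ℂ) = p * c * τ + (γ 1 1 : ℂ) := by ring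
    rw [h1]
    field_simp

lemma Gamma0_le_slashStabilizer (hp : p = 2 ∨ p = 3 ∨ p = 5) {k a b : ℤ} (hk : Even k)
    {f g : ℍ → ℂ} {P Q : ℂ⟦X⟧} (hf : HasQSeries f a P) (hg : HasQSeries g b Q)
    (hfg : ∀ τ : ℍ, f (fricke p τ) = (τ : ℂ) ^ k * g τ)
    (he : p = 5 → ∀ e, ellipticFive e ∈ slashStabilizer k f) :
    Gamma0 p ≤ slashStabilizer k f := by
  refine Gamma0_le_of_generators hp _ ?_ ?_ ?_ he
  · rw [mem_slashStabilizer]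
    intro τ
    rw [ModularGroup.SL_neg_smul, one_smul, ModularGroup.denom_apply]
    simp [hk.neg_one_zpow]
  · rw [mem_slashStabilizer]
    intro τ
    rw [UpperHalfPlane.modular_T_smul, hf.vadd_one, ModularGroup.denom_apply, ModularGroup.coe_T]
    simp
  · rw [mem_slashStabilizer]
    intro τ
    obtain ⟨w, rfl⟩ : ∃ w, τ = fricke p ((1 : ℝ) +ᵥ w) := by
      refine ⟨(-1 : ℝ) +ᵥ fricke p τ, ?_⟩
      rw [vadd_vadd]
      simp [fricke_fricke]
    have hw := w.ne_zero
    have hw1 := ((1 : ℝ) +ᵥ w).ne_zero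
    rw [coe_vadd] at hw1
    have hp : (p : ℂ) ≠ 0 := NeZero.ne _
    have h1 : lowerUnipotent p • fricke p ((1 : ℝ) +ᵥ w) = fricke p w := by
      ext
      rw [UpperHalfPlane.coe_specialLinearGroup_apply, coe_fricke, coe_fricke, coe_vadd]
      simp [lowerUnipotent]
      push_cast at hw1
      field_simp
      ring_nf
      simp [hw]
    have h2 : denom (lowerUnipotent p) (fricke p ((1 : ℝ) +ᵥ w)) = w / ((1 : ℝ) +ᵥ w : ℍ) := by
      rw [ModularGroup.denom_apply, coe_fricke, coe_vadd]
      simp [lowerUnipotent]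
      push_cast at hw1
      field_simp
      ring
    rw [h1, h2, hfg, hfg, hg.vadd_one, div_zpow, ← mul_assoc,
      div_mul_cancel₀ _ (zpow_ne_zero _ (UpperHalfPlane.ne_zero _))]

lemma isBoundedAtImInfty_slash (hp : p.Prime) {k : ℤ} {f g : ℍ → ℂ} (h : IsFrickePair p k f g)
    (hf : IsBoundedAtImInfty f) (hg : IsBoundedAtImInfty g) (γ : SL(2, ℤ)) :
    IsBoundedAtImInfty (f ∣[k] γ) := by
  by_cases hc : (p : ℤ) ∣ γ 1 0
  · have : f ∣[k] γ = f := h.le_stabilizer (by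
      rw [Gamma0_mem]; exact (ZMod.intCast_zmod_eq_zero_iff_dvd _ _).mpr hc)
    rwa [this]
  obtain ⟨n, hn⟩ : ∃ n : ℤ, (p : ℤ) ∣ γ 1 1 - n * γ 1 0 := by
    obtain ⟨u, v, huv⟩ := (Nat.prime_iff_prime_int.mp hp).coprime_iff_not_dvd.mpr hc
    refine ⟨γ 1 1 * v, u * γ 1 1, ?_⟩
    linear_combination (-γ 1 1 : ℤ) * huv
  have hγ0 : γ * ModularGroup.T ^ (-n) * ModularGroup.S⁻¹ ∈ Gamma0 p := by
    rw [Gamma0_mem, ZMod.intCast_zmod_eq_zero_iff_dvd]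
    obtain ⟨u, hu⟩ := hn
    refine ⟨-u, ?_⟩
    rw [Matrix.SpecialLinearGroup.coe_mul, Matrix.SpecialLinearGroup.coe_mul,
      ModularGroup.coe_T_zpow, Matrix.SpecialLinearGroup.coe_inv, ModularGroup.coe_S,
      Matrix.adjugate_fin_two]
    simp [Matrix.mul_apply, Fin.sum_univ_two]
    linear_combination -hu
  have hdec : γ = γ * ModularGroup.T ^ (-n) * ModularGroup.S⁻¹ *
      (ModularGroup.S * ModularGroup.T ^ n) := by group
  have hslash : f ∣[k] γ = f ∣[k] (ModularGroup.S * ModularGroup.T ^ n) := by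
    conv_lhs => rw [hdec, SlashAction.slash_mul, show f ∣[k] _ = f from h.le_stabilizer hγ0]
  have hp0 : (p : ℂ) ≠ 0 := NeZero.ne _
  have hval : ∀ τ : ℍ, (f ∣[k] γ) τ = (p : ℂ) ^ (-k) * g (rscale (p : ℝ)⁻¹
      (by simpa using hp.pos) ((n : ℝ) +ᵥ τ)) := by
    intro τ
    set w := rscale (p : ℝ)⁻¹ (by simpa using hp.pos) ((n : ℝ) +ᵥ τ) with hw
    have hcw : (w : ℂ) = (τ + n) / p := by
      simp [hw, rscale, coe_vadd]; ring
    have hne : (τ + n : ℂ) ≠ 0 := by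
      have := ((n : ℝ) +ᵥ τ).ne_zero
      rw [coe_vadd] at this
      simpa [add_comm] using this
    have h1 : (ModularGroup.S * ModularGroup.T ^ n) • τ = fricke p w := by
      rw [mul_smul, UpperHalfPlane.modular_T_zpow_smul, ← neginv_eq]
      ext
      rw [coe_neginv, coe_fricke, hcw, coe_vadd, mul_div_cancel₀ _ hp0]
      simp [add_comm]
    have h2 : denom (ModularGroup.S * ModularGroup.T ^ n : SL(2, ℤ)) τ = τ + n := by
      rw [ModularGroup.denom_apply]
      simp [ModularGroup.coe_T_zpow, ModularGroup.coe_S]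
    rw [hslash, ModularForm.SL_slash_apply, h1, h2, h.fricke_eq, hcw, div_zpow, zpow_neg, zpow_neg]
    field_simp
  rw [isBoundedAtImInfty_iff] at hg ⊢
  obtain ⟨M, A, hMA⟩ := hg
  refine ⟨‖(p : ℂ) ^ (-k)‖ * M, p * A, fun τ hτ ↦ ?_⟩
  rw [hval, norm_mul]
  refine mul_le_mul_of_nonneg_left (hMA _ ?_) (norm_nonneg _)
  have : (rscale (p : ℝ)⁻¹ (by simpa using hp.pos) ((n : ℝ) +ᵥ τ)).im = (p : ℝ)⁻¹ * τ.im := by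
    rw [← UpperHalfPlane.coe_im]
    simp [rscale, coe_vadd]
  rw [this, le_inv_mul_iff₀ (by exact_mod_cast hp.pos)]
  exact hτ

lemma IsFrickePair.exists_modularForm (hp : p.Prime) {k : ℤ} {f g : ℍ → ℂ}
    (h : IsFrickePair p k f g) (hf : IsBoundedAtImInfty f) (hg : IsBoundedAtImInfty g) :
    ∃ F : ModularForm (Gamma0 p) k, ⇑F = f := by
  refine ⟨{ toFun := f, slash_action_eq' := ?_, holo' := h.holo, bdd_at_cusps' := ?_ }, rfl⟩
  · rintro _ ⟨γ, hγ, rfl⟩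
    exact h.le_stabilizer hγ
  · intro c hc
    rw [Subgroup.IsArithmetic.isCusp_iff_isCusp_SL2Z] at hc
    rw [OnePoint.isBoundedAt_iff_forall_SL2Z hc]
    intro γ _
    exact isBoundedAtImInfty_slash hp h hf hg γ

end ScaleSMul

/-- The square of the Dedekind eta function. -/
def etaSq (τ : ℍ) : ℂ := ModularForm.eta τ ^ 2

/-- The square of the Euler product `∏ (1 - q ^ n)`. -/
def eulerSq (τ : ℍ) : ℂ := (∏' n : ℕ, (1 - qexp τ ^ (n + 1))) ^ 2

lemma etaSq_eq (τ : ℍ) : etaSq τ = Complex.exp (2 * π * Complex.I * τ / 12) * eulerSq τ := by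
  have h : ∀ n : ℕ, ModularForm.eta_q n τ = qexp τ ^ (n + 1) := fun n ↦ by
    rw [ModularForm.eta_q, qexp_eq_qParam]
  rw [etaSq, eulerSq, ModularForm.eta, mul_pow]
  simp only [h, Function.Periodic.qParam, ← Complex.exp_nat_mul]
  congr 2
  push_cast
  ring

lemma etaSq_ne_zero (τ : ℍ) : etaSq τ ≠ 0 := pow_ne_zero _ (ModularForm.eta_ne_zero τ.2)

lemma eulerSq_ne_zero (τ : ℍ) : eulerSq τ ≠ 0 :=
  right_ne_zero_of_mul (etaSq_eq τ ▸ etaSq_ne_zero τ)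

lemma mdifferentiable_etaSq : MDifferentiable 𝓘(ℂ) 𝓘(ℂ) etaSq := by
  rw [UpperHalfPlane.mdifferentiable_iff]
  have h : DifferentiableOn ℂ (fun z ↦ ModularForm.eta z ^ 2) {z | 0 < z.im} := fun z hz ↦
    ((ModularForm.differentiableAt_eta_of_mem_upperHalfPlaneSet hz).pow 2).differentiableWithinAt
  exact h.congr fun z hz ↦ by simp [etaSq, ofComplex_apply_of_im_pos hz]

lemma mdifferentiable_eulerSq : MDifferentiable 𝓘(ℂ) 𝓘(ℂ) eulerSq := by
  have h := mdifferentiable_etaSq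
  rw [UpperHalfPlane.mdifferentiable_iff] at h ⊢
  have h2 : DifferentiableOn ℂ (fun z ↦ Complex.exp (-(2 * π * Complex.I * z / 12)))
      {z | 0 < z.im} := by
    fun_prop
  refine (h2.mul h).congr fun z hz ↦ ?_
  simp only [Function.comp_apply, etaSq_eq, ofComplex_apply_of_im_pos hz, Pi.mul_apply]
  rw [← mul_assoc, ← Complex.exp_add, neg_add_cancel, Complex.exp_zero, one_mul]

lemma etaSq_vadd_one (τ : ℍ) :
    etaSq ((1 : ℝ) +ᵥ τ) = Complex.exp (2 * π * Complex.I / 12) * etaSq τ := by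
  rw [etaSq_eq, etaSq_eq, eulerSq, eulerSq, qexp_vadd_one, ← mul_assoc, ← Complex.exp_add, coe_vadd]
  congr 3
  push_cast
  ring

lemma etaSq_neginv (τ : ℍ) : etaSq (neginv τ) = -Complex.I * τ * etaSq τ := by
  have h := ModularForm.eta_comp_eq_csqrt_I_inv τ.2
  have h1 : (-1 / (τ : ℂ)) = neginv τ := by
    rw [coe_neginv]; field_simp
  simp only [Function.comp_apply, h1, Pi.smul_apply, Pi.mul_apply, smul_eq_mul] at h
  rw [etaSq, h, mul_pow, mul_pow, inv_pow]
  simp only [Complex.sqrt, ← Complex.cpow_nat_mul]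
  simp [etaSq]
  ring

lemma hasUnitalQSeries_eulerSq : HasUnitalQSeries eulerSq 0 := by
  classical
  let w : Finset ℕ → ℕ := fun s ↦ ∑ i ∈ s, (i + 1)
  have hfib (n : ℕ) : {s | w s = n}.Finite := by
    refine (Finset.finite_toSet (Finset.range n).powerset).subset fun s hs ↦ ?_
    simp only [Finset.coe_powerset, Set.mem_preimage, Set.mem_powerset_iff, Finset.coe_subset]
    intro i hi
    rw [Finset.mem_range, ← show w s = n from hs]
    exact Finset.single_le_sum (f := fun i ↦ i + 1) (fun _ _ ↦ Nat.zero_le _) hi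
  let c : ℕ → ℤ := fun n ↦ ∑ s ∈ (hfib n).toFinset, (-1) ^ s.card
  have hmain : HasUnitalQSeries (fun τ ↦ ∏' n : ℕ, (1 - qexp τ ^ (n + 1))) 0 := by
    refine ⟨_, ⟨PowerSeries.mk c, ?_, rfl⟩, fun τ ↦ ?_⟩
    · rw [← coeff_zero_eq_constantCoeff_apply, coeff_mk]
      have : (hfib 0).toFinset = {∅} := by
        ext s
        simp [w, Finset.eq_empty_iff_forall_notMem]
      simp [c, this]
    · have hs : Summable fun n : ℕ ↦ ‖-qexp τ ^ (n + 1)‖ := by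
        simpa [summable_nat_add_iff] using
          summable_geometric_of_lt_one (norm_nonneg _) (norm_qexp_lt_one τ)
      have h1 := (summable_finsetProd_of_summable_norm hs).hasSum
      rw [← tprod_one_add h1.summable, ← (Equiv.sigmaFiberEquiv w).hasSum_iff] at h1
      have h2 := h1.sigma (g := fun n ↦ (c n : ℂ) * qexp τ ^ n) fun n ↦ by
        have : Fintype {s // w s = n} := (hfib n).fintype
        have h3 := hasSum_fintype (fun s : {s // w s = n} ↦ (-1 : ℂ) ^ s.1.card * qexp τ ^ n)
        refine h3.congr_left_right (fun s ↦ ?_) ?_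
        · simp [Equiv.sigmaFiberEquiv, Finset.prod_neg, Finset.prod_pow_eq_pow_sum, ← s.2, w]
        · rw [← Finset.sum_mul]
          congr 1
          simp only [c, Int.cast_sum, Int.cast_pow, Int.cast_neg, Int.cast_one]
          exact (Finset.sum_subtype _ (fun s ↦ by simp) _)
      simpa [sub_eq_add_neg] using h2
  have h := hmain.pow 2
  rwa [mul_zero] at h

lemma HasUnitalQSeries.zpow {f : ℍ → ℂ} (hf : HasUnitalQSeries f 0)
    (hol : MDifferentiable 𝓘(ℂ) 𝓘(ℂ) f) (h0 : ∀ τ, f τ ≠ 0) (n : ℤ) :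
    HasUnitalQSeries (fun τ ↦ f τ ^ n) 0 := by
  obtain ⟨n, rfl | rfl⟩ := n.eq_nat_or_neg
  · simpa using hf.pow n
  · simpa using (hf.inv hol h0).pow n

lemma HasUnitalQSeries.qexp_zpow_mul {f : ℍ → ℂ} (hf : HasUnitalQSeries f 0) (a : ℤ) :
    HasUnitalQSeries (fun τ ↦ qexp τ ^ a * f τ) a := by
  obtain ⟨P, hP, hfP⟩ := hf
  refine ⟨P, hP, fun τ ↦ (hfP.hasSum_zero τ).congr_left_right (fun _ ↦ rfl) ?_⟩
  rw [← mul_assoc, ← zpow_add₀ (qexp_ne_zero τ), neg_add_cancel, zpow_zero, one_mul]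

lemma mdifferentiable_zpow {f : ℍ → ℂ} (hol : MDifferentiable 𝓘(ℂ) 𝓘(ℂ) f)
    (h0 : ∀ τ, f τ ≠ 0) (n : ℤ) : MDifferentiable 𝓘(ℂ) 𝓘(ℂ) fun τ ↦ f τ ^ n := by
  rw [UpperHalfPlane.mdifferentiable_iff] at hol ⊢
  exact hol.zpow (Or.inl fun z _ ↦ h0 _)

lemma mdifferentiable_comp_scale (p : ℕ) [NeZero p] {f : ℍ → ℂ}
    (hol : MDifferentiable 𝓘(ℂ) 𝓘(ℂ) f) :
    MDifferentiable 𝓘(ℂ) 𝓘(ℂ) fun τ ↦ f (scale p τ) := by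
  rw [UpperHalfPlane.mdifferentiable_iff] at hol ⊢
  have hmaps : Set.MapsTo (fun z : ℂ ↦ p * z) {z | 0 < z.im} {z | 0 < z.im} := fun z hz ↦ by
    simpa using mul_pos (Nat.cast_pos.mpr (NeZero.pos p)) hz
  refine (hol.comp (by fun_prop : DifferentiableOn ℂ (fun z : ℂ ↦ p * z) _) hmaps).congr
    fun z hz ↦ ?_
  simp only [Function.comp_apply]
  congr 1
  ext
  rw [coe_scale, ofComplex_apply_of_im_pos hz, ofComplex_apply_of_im_pos (hmaps hz)]

lemma HasQSeries.comp_scale {p : ℕ} [NeZero p] {f : ℍ → ℂ} {a : ℤ} {P : ℂ⟦X⟧}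
    (hf : HasQSeries f a P) :
    HasQSeries (fun τ ↦ f (scale p τ)) (p * a) (expand p (NeZero.ne p) P) :=
  hf.rscale _ _

lemma HasUnitalQSeries.comp_scale {p : ℕ} [NeZero p] {f : ℍ → ℂ} {a : ℤ}
    (hf : HasUnitalQSeries f a) : HasUnitalQSeries (fun τ ↦ f (scale p τ)) (p * a) :=
  hf.rscale (NeZero.ne p) _

lemma denom_mul_apply (γ γ' : SL(2, ℤ)) (τ : ℍ) :
    denom (γ * γ' : SL(2, ℤ)) τ = denom γ (γ' • τ : ℍ) * denom γ' τ := by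
  have h0 := denom_ne_zero γ' τ
  rw [ModularGroup.denom_apply] at h0
  rw [ModularGroup.denom_apply, ModularGroup.denom_apply, ModularGroup.denom_apply,
    UpperHalfPlane.coe_specialLinearGroup_apply, Matrix.SpecialLinearGroup.coe_mul]
  simp [Matrix.mul_apply, Fin.sum_univ_two]
  field_simp
  ring

lemma exists_etaSq_smul (γ : SL(2, ℤ)) :
    ∃ ζ : ℂ, ∀ τ : ℍ, etaSq (γ • τ) = ζ * denom γ τ * etaSq τ := by
  have hγ : γ ∈ Subgroup.closure {ModularGroup.S, ModularGroup.T} := by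
    rw [SpecialLinearGroup.SL2Z_generators]; trivial
  induction hγ using Subgroup.closure_induction with
  | mem γ h =>
    rcases h with rfl | rfl
    · refine ⟨-Complex.I, fun τ ↦ ?_⟩
      rw [← neginv_eq, etaSq_neginv, ModularGroup.denom_S]
    · refine ⟨Complex.exp (2 * π * Complex.I / 12), fun τ ↦ ?_⟩
      rw [UpperHalfPlane.modular_T_smul, etaSq_vadd_one, ModularGroup.denom_apply,
        ModularGroup.coe_T]
      simp
  | one => exact ⟨1, fun τ ↦ by simp⟩
  | mul γ γ' _ _ h h' =>
    obtain ⟨ζ, h⟩ := h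
    obtain ⟨ζ', h'⟩ := h'
    refine ⟨ζ * ζ', fun τ ↦ ?_⟩
    rw [mul_smul, h, h', denom_mul_apply]
    ring
  | inv γ _ h =>
    obtain ⟨ζ, h⟩ := h
    refine ⟨ζ⁻¹, fun τ ↦ ?_⟩
    have h1 := h (γ⁻¹ • τ)
    have h2 := denom_mul_apply γ γ⁻¹ τ
    rw [mul_inv_cancel, map_one, map_one, denom_one] at h2
    rw [smul_inv_smul] at h1
    have hζ : ζ ≠ 0 := fun hζ ↦ etaSq_ne_zero τ (by rw [h1, hζ]; ring)
    rw [h1]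
    field_simp
    linear_combination etaSq (γ⁻¹ • τ) * h2

lemma fixed_point_ellipticFive (e : ℤˣ) :
    ∃ τ : ℍ, ellipticFive e • τ = τ ∧ denom (ellipticFive e) τ = Complex.I := by
  have h0 : 0 < ((2 * ((e : ℤ) : ℂ) + Complex.I) / 5).im := by
    rcases Int.units_eq_one_or e with rfl | rfl <;> norm_num
  have h1 : denom (ellipticFive e) (⟨_, h0⟩ : ℍ) = Complex.I := by
    rw [ModularGroup.denom_apply]
    simp [ellipticFive]
    ring
  refine ⟨⟨_, h0⟩, ?_, h1⟩
  ext
  have he : ((e : ℤ) : ℂ) ^ 2 = 1 := by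
    rcases Int.units_eq_one_or e with rfl | rfl <;> norm_num
  rw [ModularGroup.denom_apply] at h1
  rw [UpperHalfPlane.coe_specialLinearGroup_apply]
  simp only [ellipticFive] at h1 ⊢
  simp at h1 ⊢
  rw [h1, div_eq_iff Complex.I_ne_zero]
  linear_combination (4 / 5 : ℂ) * he - (1 / 5 : ℂ) * Complex.I_sq

/-- The eta quotient `η(p * τ) ^ (2 * X) * η(τ) ^ (2 * Y)`. -/
def etaQuotient (p : ℕ) [NeZero p] (X Y : ℤ) (τ : ℍ) : ℂ := etaSq (scale p τ) ^ X * etaSq τ ^ Y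

section EtaQuotient

variable {p : ℕ} [NeZero p] {X Y : ℤ}

lemma etaQuotient_ne_zero (τ : ℍ) : etaQuotient p X Y τ ≠ 0 :=
  mul_ne_zero (zpow_ne_zero _ (etaSq_ne_zero _)) (zpow_ne_zero _ (etaSq_ne_zero _))

lemma mdifferentiable_etaQuotient : MDifferentiable 𝓘(ℂ) 𝓘(ℂ) (etaQuotient p X Y) := by
  have h1 := mdifferentiable_zpow (mdifferentiable_comp_scale p mdifferentiable_etaSq)
    (fun τ ↦ etaSq_ne_zero _) X
  have h2 := mdifferentiable_zpow mdifferentiable_etaSq etaSq_ne_zero Y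
  rw [UpperHalfPlane.mdifferentiable_iff] at h1 h2 ⊢
  exact h1.mul h2

lemma hasUnitalQSeries_etaQuotient {a : ℤ} (ha : p * X + Y = 12 * a) :
    HasUnitalQSeries (etaQuotient p X Y) a := by
  have h0 := hasUnitalQSeries_eulerSq.comp_scale (p := p)
  rw [mul_zero] at h0
  have h1 := h0.zpow (mdifferentiable_comp_scale p mdifferentiable_eulerSq)
    (fun τ ↦ eulerSq_ne_zero _) X
  have h2 := HasUnitalQSeries.zpow hasUnitalQSeries_eulerSq mdifferentiable_eulerSq
    eulerSq_ne_zero Y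
  have h3 := (h1.mul h2).qexp_zpow_mul a
  convert h3 using 1
  ext τ
  rw [etaQuotient, etaSq_eq, etaSq_eq, mul_zpow, mul_zpow, qexp, ← Complex.exp_int_mul,
    ← Complex.exp_int_mul, ← Complex.exp_int_mul, coe_scale, mul_mul_mul_comm, ← Complex.exp_add]
  congr 2
  have : (p * X + Y : ℂ) = 12 * a := by exact_mod_cast ha
  linear_combination (2 * π * Complex.I * τ / 12) * this

lemma etaQuotient_fricke (τ : ℍ) : etaQuotient p X Y (fricke p τ) =
    (τ : ℂ) ^ (X + Y) * (((-Complex.I) ^ (X + Y) * (p : ℂ) ^ Y) * etaQuotient p Y X τ) := by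
  have h0 : -Complex.I ≠ 0 := by simp
  rw [etaQuotient, etaQuotient, scale_fricke, fricke, etaSq_neginv, etaSq_neginv, coe_scale,
    mul_zpow, mul_zpow, mul_zpow, mul_zpow, mul_zpow, zpow_add₀ h0, zpow_add₀ τ.ne_zero]
  ring

lemma ellipticFive_mem_slashStabilizer_etaQuotient (hp : p = 5) {k : ℤ} (hk : X + Y = 4 * k)
    (e : ℤˣ) : ellipticFive e ∈ slashStabilizer (X + Y) (etaQuotient p X Y) := by
  have hmem : ellipticFive e ∈ Gamma0 p := by
    subst hp
    rw [Gamma0_mem]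
    simp [ellipticFive]
    rfl
  obtain ⟨γ', -, hγ'⟩ := exists_scale_smul hmem
  obtain ⟨ζ, hζ⟩ := exists_etaSq_smul (ellipticFive e)
  obtain ⟨ζ', hζ'⟩ := exists_etaSq_smul γ'
  have key (τ : ℍ) : etaQuotient p X Y (ellipticFive e • τ) =
      (ζ' ^ X * ζ ^ Y) * (denom (ellipticFive e) τ ^ (X + Y) * etaQuotient p X Y τ) := by
    rw [etaQuotient, etaQuotient, (hγ' τ).1, hζ, hζ', (hγ' τ).2,
      zpow_add₀ (denom_ne_zero _ _), mul_zpow, mul_zpow, mul_zpow, mul_zpow]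
    ring
  obtain ⟨τ₀, h1, h2⟩ := fixed_point_ellipticFive e
  have h3 := key τ₀
  rw [h1, h2, hk, zpow_mul, show Complex.I ^ (4 : ℤ) = 1 by
    exact_mod_cast Complex.I_pow_four, one_zpow, one_mul, eq_comm,
    mul_eq_right₀ (etaQuotient_ne_zero _)] at h3
  refine mem_slashStabilizer.mpr fun τ ↦ ?_
  rw [key, h3, one_mul]

/-- `f` is modular of weight `k` for `Γ₀(p)`, with order `a` and leading coefficient `1` at `∞`,
order `b` and leading coefficient `c` at `0`, and integral expansions up to this scaling. -/
def IsUnitForm (p : ℕ) [NeZero p] (k a b : ℤ) (c : ℂ) (f : ℍ → ℂ) : Prop :=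
  ∃ g : ℍ → ℂ, IsFrickePair p k f (fun τ ↦ c * g τ) ∧ HasUnitalQSeries f a ∧ HasUnitalQSeries g b

lemma isUnitForm_etaQuotient (hp : p = 2 ∨ p = 3 ∨ p = 5) {a b : ℤ}
    (hk : Even (X + Y)) (ha : p * X + Y = 12 * a) (hb : p * Y + X = 12 * b)
    (h5 : p = 5 → (4 : ℤ) ∣ X + Y) :
    IsUnitForm p (X + Y) a b ((-Complex.I) ^ (X + Y) * (p : ℂ) ^ Y) (etaQuotient p X Y) := by
  have hf := hasUnitalQSeries_etaQuotient ha
  have hg := hasUnitalQSeries_etaQuotient hb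
  refine ⟨etaQuotient p Y X, ⟨mdifferentiable_etaQuotient, ?_, etaQuotient_fricke⟩, hf, hg⟩
  obtain ⟨P, -, hP⟩ := hf
  obtain ⟨Q, -, hQ⟩ := hg
  refine Gamma0_le_slashStabilizer hp hk hP (hQ.smul _) etaQuotient_fricke fun h e ↦ ?_
  obtain ⟨l, hl⟩ := h5 h
  exact ellipticFive_mem_slashStabilizer_etaQuotient h hl e

end EtaQuotient

namespace IsUnitForm

variable {p : ℕ} [NeZero p] {k l a b a' b' : ℤ} {c c' : ℂ} {f f' : ℍ → ℂ}

lemma mul (h : IsUnitForm p k a b c f) (h' : IsUnitForm p l a' b' c' f') :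
    IsUnitForm p (k + l) (a + a') (b + b') (c * c') (fun τ ↦ f τ * f' τ) := by
  obtain ⟨g, h1, h2, h3⟩ := h
  obtain ⟨g', h1', h2', h3'⟩ := h'
  refine ⟨fun τ ↦ g τ * g' τ, ?_, h2.mul h2', h3.mul h3'⟩
  simpa only [mul_mul_mul_comm] using h1.mul h1'

lemma pow (h : IsUnitForm p k a b c f) (n : ℕ) :
    IsUnitForm p (n * k) (n * a) (n * b) (c ^ n) (fun τ ↦ f τ ^ n) := by
  obtain ⟨g, h1, h2, h3⟩ := h
  refine ⟨fun τ ↦ g τ ^ n, ?_, h2.pow n, h3.pow n⟩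
  simpa only [mul_pow] using h1.pow n

end IsUnitForm

/-- The generating series of the divisor power sums `σ_j`. -/
def sigmaSeries (j : ℕ) : ℤ⟦X⟧ := PowerSeries.mk fun n ↦ (ArithmeticFunction.sigma j n : ℤ)

lemma constantCoeff_sigmaSeries (j : ℕ) : constantCoeff (sigmaSeries j) = 0 := by
  rw [← coeff_zero_eq_constantCoeff_apply, sigmaSeries, coeff_mk]
  simp

open EisensteinSeries ModularForm in
lemma hasQSeries_E2 : HasQSeries E2 0
    (PowerSeries.map (Int.castRingHom ℂ) (1 - C 24 * sigmaSeries 1)) := by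
  intro τ
  refine (hasSum_qExpansion_E2 (z := τ)).congr_left_right (fun n ↦ ?_) (by simp)
  rw [smul_eq_mul]
  change _ = _ * qexp τ ^ n
  rw [PowerSeries.coeff_map, map_sub, coeff_C_mul]
  congr 1
  rcases eq_or_ne n 0 with rfl | hn
  · simp [constantCoeff_sigmaSeries]
  · simp [hn, coeff_one, sigmaSeries]

open EisensteinSeries ModularForm in
lemma hasQSeries_E₄ : HasQSeries E₄ 0
    (PowerSeries.map (Int.castRingHom ℂ) (1 + C 240 * sigmaSeries 3)) := by
  intro τ
  refine (ModularForm.hasSum_qExpansion (f := E₄) one_pos one_mem_strictPeriods_SL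
    τ).congr_left_right (fun n ↦ ?_) (by simp)
  rw [← qexp_eq_qParam, E_qExpansion_coeff _ (by decide)]
  rw [PowerSeries.coeff_map, map_add, coeff_C_mul]
  congr 1
  rcases eq_or_ne n 0 with rfl | hn
  · simp [constantCoeff_sigmaSeries]
  · have : bernoulli 4 = -1 / 30 := by
      rw [bernoulli_eq_bernoulli'_of_ne_one (by norm_num), bernoulli'_four]
    simp [hn, coeff_one, sigmaSeries, this]
    norm_num

open EisensteinSeries ModularForm in
lemma exists_E2_smul : ∃ K : ℂ, ∀ (γ : SL(2, ℤ)) (τ : ℍ),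
    E2 (γ • τ) = denom γ τ ^ 2 * E2 τ - K * (γ 1 0 : ℂ) * denom γ τ := by
  refine ⟨1 / (2 * riemannZeta 2) * (2 * π * Complex.I), fun γ τ ↦ ?_⟩
  have h := congrFun (E2_slash_action γ) τ
  have h0 := denom_ne_zero γ τ
  rw [ModularForm.SL_slash_apply, zpow_neg, mul_inv_eq_iff_eq_mul₀ (zpow_ne_zero _ h0)] at h
  rw [h]
  simp only [Pi.sub_apply, Pi.smul_apply, D2, smul_eq_mul]
  rw [show (2 : ℤ) = (2 : ℕ) from rfl, zpow_natCast]
  field_simp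

open EisensteinSeries ModularForm in
lemma E₄_smul (γ : SL(2, ℤ)) (τ : ℍ) : E₄ (γ • τ) = denom γ τ ^ (4 : ℤ) * E₄ τ := by
  have h : γ ∈ slashStabilizer 4 E₄ := E₄.slash_action_eq' _ ⟨γ, rfl⟩
  exact mem_slashStabilizer.mp h τ

lemma fricke_eq_smul {p : ℕ} [NeZero p] (τ : ℍ) : fricke p τ = ModularGroup.S • scale p τ := by
  rw [← neginv_eq, fricke]

open EisensteinSeries ModularForm in
/-- The weight two Eisenstein series `(p E₂(pτ) - E₂(τ)) / (p - 1)`. -/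
lemma exists_isUnitForm_two {p : ℕ} [NeZero p] {r : ℤ} (hr : (p - 1) * r = 24) :
    ∃ f, IsUnitForm p 2 0 0 (-p) f := by
  obtain ⟨K, hK⟩ := exists_E2_smul
  have hr0 : (r : ℂ) / 24 ≠ 0 := by
    have : r ≠ 0 := by rintro rfl; simp at hr
    simpa using this
  have hq : HasUnitalQSeries (fun τ ↦ (r / 24 : ℂ) * (p * E2 (scale p τ) - E2 τ)) 0 := by
    have h1 := hasQSeries_E2.comp_scale (p := p)
    rw [mul_zero] at h1
    have h := ((h1.smul (p : ℂ)).sub hasQSeries_E2).smul (r / 24 : ℂ)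
    refine ⟨_, ⟨1 + C r * (sigmaSeries 1 - C (p : ℤ) * expand p (NeZero.ne p) (sigmaSeries 1)),
      by simp [constantCoeff_sigmaSeries], rfl⟩, ?_⟩
    convert! h using 1
    have hr' : (C ((r : ℂ) / 24) : ℂ⟦X⟧) * ((C (p : ℂ) - 1)) = 1 := by
      rw [← map_one C, ← map_sub, ← map_mul]
      congr 1
      have : ((p : ℂ) - 1) * r = 24 := mod_cast hr
      linear_combination this / 24
    have hr'' : (C (r : ℂ) : ℂ⟦X⟧) = C ((r : ℂ) / 24) * C 24 := by
      rw [← map_mul]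
      simp
    simp only [map_add, map_sub, map_mul, map_one, map_C, map_expand, Int.coe_castRingHom, hr'',
      Int.cast_natCast, expand_C, Int.cast_ofNat]
    linear_combination -hr'
  refine ⟨_, _, ⟨?_, ?_, ?_⟩, hq, hq⟩
  · have h1 := E2_mdifferentiable
    have h2 := mdifferentiable_comp_scale p h1
    rw [UpperHalfPlane.mdifferentiable_iff] at h1 h2 ⊢
    exact ((h2.const_mul _).sub h1).const_mul _
  · intro γ hγ
    obtain ⟨γ', hcc, hγ'⟩ := exists_scale_smul hγ
    refine mem_slashStabilizer.mpr fun τ ↦ ?_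
    have hc : (p : ℂ) * (γ' 1 0 : ℂ) = γ 1 0 := mod_cast hcc
    simp only [(hγ' τ).1, hK, (hγ' τ).2, ← hc]
    rw [show (2 : ℤ) = (2 : ℕ) from rfl, zpow_natCast]
    ring
  · intro τ
    simp only [scale_fricke]
    simp only [neginv_eq, fricke_eq_smul, hK]
    rw [ModularGroup.denom_S, ModularGroup.denom_S, coe_scale, ModularGroup.coe_S]
    simp
    ring

open EisensteinSeries ModularForm in
lemma exists_isUnitForm_three_four : ∃ f, IsUnitForm 3 4 1 0 (1 / 3) f := by
  have h := hasQSeries_E₄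
  have h3 := hasQSeries_E₄.comp_scale (p := 3)
  rw [mul_zero] at h3
  refine ⟨fun τ ↦ (1 / 240) * (E₄ τ - E₄ (scale 3 τ)),
    fun τ ↦ (1 / 80) * (81 * E₄ (scale 3 τ) - E₄ τ), ⟨?_, ?_, ?_⟩, ?_, ?_⟩
  · have h1 := E₄.holo'
    have h2 := mdifferentiable_comp_scale 3 h1
    rw [UpperHalfPlane.mdifferentiable_iff] at h1 h2 ⊢
    exact (h1.sub h2).const_mul _
  · intro γ hγ
    obtain ⟨γ', -, hγ'⟩ := exists_scale_smul hγ
    refine mem_slashStabilizer.mpr fun τ ↦ ?_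
    simp only [(hγ' τ).1, E₄_smul, (hγ' τ).2]
    ring
  · intro τ
    simp only [scale_fricke]
    simp only [neginv_eq, fricke_eq_smul, E₄_smul]
    rw [ModularGroup.denom_S, ModularGroup.denom_S, coe_scale, mul_zpow]
    norm_num
    ring
  · obtain ⟨Q, hQ⟩ : X ^ 1 ∣ sigmaSeries 3 - expand 3 (by norm_num) (sigmaSeries 3) := by
      rw [pow_one, X_dvd_iff]
      simp [constantCoeff_sigmaSeries]
    refine ⟨_, ⟨Q, ?_, rfl⟩, ?_⟩
    · have h1 := congrArg (coeff 1) hQ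
      rw [pow_one, coeff_succ_X_mul, coeff_zero_eq_constantCoeff_apply] at h1
      rw [← h1, map_sub, coeff_expand_of_not_dvd _ _ _ (by norm_num)]
      simp [sigmaSeries]
    · refine (zero_add (1 : ℤ)) ▸ HasQSeries.of_X_pow_mul (n := 1) ?_
      convert! (h.sub h3).smul (1 / 240) using 1
      have h240 : (C (1 / 240 : ℂ) : ℂ⟦X⟧) * 240 = 1 := by
        rw [← map_ofNat C 240, ← map_mul]
        simp
      have hQ' := congrArg (PowerSeries.map (Int.castRingHom ℂ)) hQ
      simp only [map_add, map_sub, map_mul, map_one, map_expand, pow_one, map_X, map_ofNat] at hQ' ⊢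
      rw [← hQ']
      linear_combination (-PowerSeries.map (Int.castRingHom ℂ) (sigmaSeries 3)
        + expand 3 (by norm_num) (PowerSeries.map (Int.castRingHom ℂ) (sigmaSeries 3))) * h240
  · refine ⟨_, ⟨1 + 3 * (81 * expand 3 (by norm_num) (sigmaSeries 3) - sigmaSeries 3),
      by simp [constantCoeff_sigmaSeries], rfl⟩, ?_⟩
    convert! ((h3.smul 81).sub h).smul (1 / 80) using 1
    have h80 : (C (1 / 80 : ℂ) : ℂ⟦X⟧) * 80 = 1 := by
      rw [← map_ofNat C 80, ← map_mul]
      simp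
    have h81 : (C 81 : ℂ⟦X⟧) = 81 := map_ofNat C 81
    simp only [map_add, map_sub, map_mul, map_one, map_expand, h81, map_ofNat]
    linear_combination (-1 - 3 * (81 * expand 3 (by norm_num)
      (PowerSeries.map (Int.castRingHom ℂ) (sigmaSeries 3))
      - PowerSeries.map (Int.castRingHom ℂ) (sigmaSeries 3))) * h80

section Valence

variable {p : ℕ} {k : ℤ}

lemma hasQSeries_modularForm (F : ModularForm (Gamma0 p) k) :
    HasQSeries F 0 (qExpansion 1 F) := by
  intro τ
  have h1 : (1 : ℝ) ∈ (Gamma0 p : Subgroup (GL (Fin 2) ℝ)).strictPeriods := by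
    rw [strictPeriods_Gamma0]
    exact AddSubgroup.mem_zmultiples _
  have : Fact (IsCusp .infty (Gamma0 p : Subgroup (GL (Fin 2) ℝ))) :=
    ⟨Subgroup.isCusp_of_mem_strictPeriods one_pos h1⟩
  refine (ModularForm.hasSum_qExpansion (f := F) one_pos h1 τ).congr_left_right (fun n ↦ ?_)
    (by simp)
  rw [qexp_eq_qParam]

variable [NeZero p]

lemma tendsto_scale_atImInfty : Tendsto (scale p) atImInfty atImInfty := by
  refine tendsto_comap_iff.mpr ?_
  have : UpperHalfPlane.im ∘ scale p = fun τ ↦ (p : ℝ) * τ.im := by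
    ext τ
    rw [Function.comp_apply, ← UpperHalfPlane.coe_im, coe_scale]
    simp
  rw [this]
  exact tendsto_comap.const_mul_atTop (by exact_mod_cast NeZero.pos p)

lemma exists_isFrickePair_modularForm (F : ModularForm (Gamma0 p) k) :
    ∃ g, IsFrickePair p k F g ∧ IsBoundedAtImInfty g := by
  refine ⟨fun τ ↦ (p : ℂ) ^ k * ((F : ℍ → ℂ) ∣[k] ModularGroup.S) (scale p τ),
    ⟨F.holo', fun γ hγ ↦ ?_,
    fun τ ↦ ?_⟩, ?_⟩
  · exact F.slash_action_eq' _ ⟨γ, hγ, rfl⟩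
  · have hS := ModularGroup.denom_S (scale p τ)
    rw [ModularForm.SL_slash_apply, hS, coe_scale, ← neginv_eq, fricke, zpow_neg, mul_zpow]
    have := zpow_ne_zero k τ.ne_zero
    have : (p : ℂ) ^ k ≠ 0 := zpow_ne_zero k (NeZero.ne _)
    field_simp
  · have h : IsBoundedAtImInfty ((F : ℍ → ℂ) ∣[k] ModularGroup.S) :=
      ModularFormClass.bdd_at_infty_slash F _
    exact (h.comp_tendsto tendsto_scale_atImInfty).const_mul_left _

lemma isBoundedAtImInfty_pow {g : ℍ → ℂ} (hg : IsBoundedAtImInfty g) (n : ℕ) :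
    IsBoundedAtImInfty fun τ ↦ g τ ^ n := by
  induction n with
  | zero =>
    simp only [pow_zero]
    exact const_boundedAtFilter _ (1 : ℂ)
  | succ n ih =>
    simp only [pow_succ]
    exact BoundedAtFilter.mul ih hg

/-- A weight `k` form of large order at `∞` vanishes: compare it with an eta quotient. -/
lemma modularForm_eq_zero_of_order (hp : p = 2 ∨ p = 3 ∨ p = 5) {X Y : ℤ} {o n : ℤ} {w : ℕ}
    (hw : w ≠ 0) (hw' : Even w) (hXY : X + Y = w) (ho : p * X + Y = 12 * o) (hY : p * Y + X = 0)
    (h5 : p = 5 → (4 : ℤ) ∣ w) (F : ModularForm (Gamma0 p) k) {P : ℂ⟦X⟧}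
    (hF : HasQSeries F n P) (hn : o * k < w * n ∨ o * k ≤ w * n ∧ ∃ τ, F τ = 0) (τ : ℍ) :
    F τ = 0 := by
  have hp' : p.Prime := by rcases hp with rfl | rfl | rfl <;> norm_num
  obtain ⟨g, hg, hgb⟩ := exists_isFrickePair_modularForm F
  have heven : Even (-(k * X) + -(k * Y)) := by
    rw [← neg_add, ← mul_add, hXY]
    exact ((by exact_mod_cast hw' : Even (w : ℤ)).mul_left k).neg
  obtain ⟨e, he, he1, heb⟩ := isUnitForm_etaQuotient (p := p) (a := -(k * o)) (b := 0) hp heven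
    (by linear_combination -k * ho) (by linear_combination -k * hY) fun h ↦ by
      rw [← neg_add, ← mul_add, hXY]
      exact (dvd_mul_of_dvd_right (h5 h) k).neg_right
  have hk : (w : ℤ) * k + (-(k * X) + -(k * Y)) = 0 := by rw [← hXY]; ring
  have h := (hg.pow w).mul he
  rw [hk] at h
  obtain ⟨Q, -, hQ⟩ := he1
  have hq := (hF.pow w).mul hQ
  have hb : IsBoundedAtImInfty fun τ ↦ F τ ^ w * etaQuotient p (-(k * X)) (-(k * Y)) τ := by
    refine hq.isBoundedAtImInfty_of_nonneg ?_
    rcases hn with hn | ⟨hn, -⟩ <;> linarith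
  have hb' : IsBoundedAtImInfty fun τ ↦ g τ ^ w * (((-Complex.I) ^ (-(k * X) + -(k * Y)) *
      (p : ℂ) ^ (-(k * Y))) * e τ) := by
    obtain ⟨Q, -, hQ⟩ := heb
    exact BoundedAtFilter.mul (isBoundedAtImInfty_pow hgb w)
      (BoundedAtFilter.mul (const_boundedAtFilter _ _) hQ.isBoundedAtImInfty)
  obtain ⟨H, hH⟩ := h.exists_modularForm hp' hb hb'
  obtain ⟨c, hc⟩ := ModularForm.eq_const_of_weight_zero H
  rw [hH] at hc
  have hc0 : c = 0 := by
    rcases hn with hn | ⟨-, τ, hτ⟩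
    · obtain ⟨R, hR⟩ := hq.of_le (b := 1) (by linarith)
      rw [hc] at hR
      have h1 := (hR.X_pow_mul 1).tendsto
      exact tendsto_nhds_unique (f := Function.const ℍ c) (l := atImInfty) tendsto_const_nhds
        (by simpa using h1)
    · simpa [hτ, hw] using (congrFun hc τ).symm
  have := congrFun hc τ
  simpa [hc0, etaQuotient_ne_zero, hw] using this

end Valence

/-- `D` is at least the maximal order at `∞` of a nonzero form in `M_k(Γ₀(p))`. -/
def IsSturmBound (p k D : ℕ) : Prop :=
  p = 2 ∧ k < 4 * (D + 1) ∨ p = 3 ∧ k < 3 * (D + 1) ∨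
    p = 5 ∧ (k < 2 * (D + 1) ∨ k = 2 * (D + 1) ∧ k % 4 = 2)

lemma modularForm_eq_zero {p : ℕ} [NeZero p] {k D : ℕ} (hD : IsSturmBound p k D)
    (F : ModularForm (Gamma0 p) (k : ℤ)) {P : ℂ⟦X⟧} (hF : HasQSeries F (D + 1) P) (τ : ℍ) :
    F τ = 0 := by
  rcases hD with ⟨rfl, h⟩ | ⟨rfl, h⟩ | ⟨rfl, h⟩
  · exact modularForm_eq_zero_of_order (X := 8) (Y := -4) (o := 1) (w := 4) (by simp)
      (by norm_num) (by decide) (by norm_num) (by norm_num) (by norm_num) (by simp) F hF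
      (.inl (by push_cast; omega)) τ
  · exact modularForm_eq_zero_of_order (X := 9) (Y := -3) (o := 2) (w := 6) (by simp)
      (by norm_num) (by decide) (by norm_num) (by norm_num) (by norm_num) (by simp) F hF
      (.inl (by push_cast; omega)) τ
  · refine modularForm_eq_zero_of_order (X := 5) (Y := -1) (o := 2) (w := 4) (by simp)
      (by norm_num) (by decide) (by norm_num) (by norm_num) (by norm_num) (by simp) F hF
      ?_ τ
    rcases h with h | ⟨h, h'⟩
    · exact .inl (by push_cast; omega)
    · refine .inr ⟨by push_cast; omega, ?_⟩
      obtain ⟨σ, hσ, hσ'⟩ := fixed_point_ellipticFive 1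
      have hmem : ellipticFive 1 ∈ Gamma0 5 := by
        rw [Gamma0_mem]
        simp [ellipticFive]
        decide
      obtain ⟨g, hg, -⟩ := exists_isFrickePair_modularForm F
      have h1 := mem_slashStabilizer.mp (hg.le_stabilizer hmem) σ
      refine ⟨σ, ?_⟩
      have h2 : Complex.I ^ k = -1 := by
        rw [← Nat.div_add_mod k 4, h', pow_add, pow_mul, Complex.I_pow_four]
        simp
      rw [hσ, hσ', zpow_natCast, h2] at h1
      linear_combination h1 / 2

lemma IsUnitForm.of_eq {p : ℕ} [NeZero p] {k a b k' a' b' : ℤ} {c c' : ℂ} {f : ℍ → ℂ}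
    (h : IsUnitForm p k a b c f) (hk : k = k') (ha : a = a') (hb : b = b') (hc : c = c') :
    IsUnitForm p k' a' b' c' f := by
  rwa [← hk, ← ha, ← hb, ← hc]

lemma I_zpow_four : (-Complex.I) ^ (4 : ℤ) = 1 := by
  rw [show (4 : ℤ) = (4 : ℕ) from rfl, zpow_natCast, neg_pow, Complex.I_pow_four]
  norm_num

lemma I_zpow_six : (-Complex.I) ^ (6 : ℤ) = -1 := by
  rw [show (6 : ℤ) = (6 : ℕ) from rfl, zpow_natCast, neg_pow, show 6 = 4 + 2 from rfl,
    pow_add Complex.I, Complex.I_pow_four]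
  norm_num

/-- A form with integral coefficients and of maximal order at `∞`, whose expansion at the other
cusp is an integral unit power series up to a constant factor `1 / c`. -/
lemma exists_isUnitForm {p : ℕ} [NeZero p] (hp : p ∈ ({2, 3, 5} : Set ℕ)) {k : ℕ}
    (hk : k ∈ ({4, 6, 8, 10, 14} : Set ℕ)) : ∃ (D : ℕ) (c : ℤ) (T : ℍ → ℂ),
      IsSturmBound p k D ∧ c ≠ 0 ∧ IsUnitForm p k D 0 (c : ℂ)⁻¹ T := by
  rcases hp with rfl | rfl | rfl
  · have hR := isUnitForm_etaQuotient (p := 2) (X := 8) (Y := -4) (a := 1) (b := 0) (by simp)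
      (by decide) (by norm_num) (by norm_num) (by simp)
    obtain ⟨A, hA⟩ := exists_isUnitForm_two (p := 2) (r := 24) (by norm_num)
    simp only [Int.reduceAdd, I_zpow_four] at hR
    rcases hk with rfl | rfl | rfl | rfl | rfl
    · exact ⟨1, 16, _, by norm_num [IsSturmBound], by norm_num, hR.of_eq rfl rfl rfl (by norm_num)⟩
    · exact ⟨1, -8, _, by norm_num [IsSturmBound], by norm_num,
        (hR.mul hA).of_eq rfl rfl rfl (by norm_num)⟩
    · exact ⟨2, 256, _, by norm_num [IsSturmBound], by norm_num,
        (hR.pow 2).of_eq rfl rfl rfl (by norm_num)⟩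
    · exact ⟨2, -128, _, by norm_num [IsSturmBound], by norm_num,
        ((hR.pow 2).mul hA).of_eq rfl rfl rfl (by norm_num)⟩
    · exact ⟨3, -2048, _, by norm_num [IsSturmBound], by norm_num,
        ((hR.pow 3).mul hA).of_eq rfl rfl rfl (by norm_num)⟩
  · have hR := isUnitForm_etaQuotient (p := 3) (X := 9) (Y := -3) (a := 2) (b := 0) (by simp)
      (by decide) (by norm_num) (by norm_num) (by simp)
    obtain ⟨V, hV⟩ := exists_isUnitForm_three_four
    simp only [Int.reduceAdd, I_zpow_six] at hR
    rcases hk with rfl | rfl | rfl | rfl | rfl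
    · exact ⟨1, 3, _, by norm_num [IsSturmBound], by norm_num, hV.of_eq rfl rfl rfl (by norm_num)⟩
    · exact ⟨2, -27, _, by norm_num [IsSturmBound], by norm_num, hR.of_eq rfl rfl rfl (by norm_num)⟩
    · exact ⟨2, 9, _, by norm_num [IsSturmBound], by norm_num,
        (hV.pow 2).of_eq rfl rfl rfl (by norm_num)⟩
    · exact ⟨3, -81, _, by norm_num [IsSturmBound], by norm_num,
        (hR.mul hV).of_eq rfl rfl rfl (by norm_num)⟩
    · exact ⟨4, -243, _, by norm_num [IsSturmBound], by norm_num,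
        (hR.mul (hV.pow 2)).of_eq rfl rfl rfl (by norm_num)⟩
  · have hR := isUnitForm_etaQuotient (p := 5) (X := 5) (Y := -1) (a := 2) (b := 0) (by simp)
      (by decide) (by norm_num) (by norm_num) (by simp)
    obtain ⟨A, hA⟩ := exists_isUnitForm_two (p := 5) (r := 6) (by norm_num)
    simp only [Int.reduceAdd, I_zpow_four] at hR
    rcases hk with rfl | rfl | rfl | rfl | rfl
    · exact ⟨2, 5, _, by norm_num [IsSturmBound], by norm_num, hR.of_eq rfl rfl rfl (by norm_num)⟩
    · exact ⟨2, -1, _, by norm_num [IsSturmBound], by norm_num,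
        (hR.mul hA).of_eq rfl rfl rfl (by norm_num)⟩
    · exact ⟨4, 25, _, by norm_num [IsSturmBound], by norm_num,
        (hR.pow 2).of_eq rfl rfl rfl (by norm_num)⟩
    · exact ⟨4, -5, _, by norm_num [IsSturmBound], by norm_num,
        ((hR.pow 2).mul hA).of_eq rfl rfl rfl (by norm_num)⟩
    · exact ⟨6, -25, _, by norm_num [IsSturmBound], by norm_num,
        ((hR.pow 3).mul hA).of_eq rfl rfl rfl (by norm_num)⟩

/-- The powers of the Hauptmodul `(η(pτ)/η(τ))^(24/(p-1))` of `Γ₀(p)`. -/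
lemma exists_isUnitForm_zero {p : ℕ} [NeZero p] (hp : p ∈ ({2, 3, 5} : Set ℕ)) (j : ℤ) :
    ∃ f, IsUnitForm p 0 j (-j) (((p : ℂ) ^ (12 / (p - 1) : ℕ)) ^ (-j)) f := by
  rcases hp with rfl | rfl | rfl
  · exact ⟨_, (isUnitForm_etaQuotient (p := 2) (X := 12 * j) (Y := -(12 * j)) (a := j) (b := -j)
      (by simp) (by simp) (by push_cast; ring) (by push_cast; ring) (by simp)).of_eq (by simp)
      rfl rfl (by simp [zpow_mul])⟩
  · exact ⟨_, (isUnitForm_etaQuotient (p := 3) (X := 6 * j) (Y := -(6 * j)) (a := j) (b := -j)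
      (by simp) (by simp) (by push_cast; ring) (by push_cast; ring) (by simp)).of_eq (by simp)
      rfl rfl (by simp [zpow_mul])⟩
  · exact ⟨_, (isUnitForm_etaQuotient (p := 5) (X := 3 * j) (Y := -(3 * j)) (a := j) (b := -j)
      (by simp) (by simp) (by push_cast; ring) (by push_cast; ring) (by simp)).of_eq (by simp)
      rfl rfl (by simp [zpow_mul])⟩

section Triangular

variable {S : AddSubgroup ℂ} {h : ℕ → ℂ⟦X⟧} {N : ℕ} {P Q : ℂ⟦X⟧}

lemma Unital.coeff_X_pow_mul (hQ : Unital Q) (i n : ℕ) :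
    ∃ z : ℤ, coeff n (X ^ i * Q) = (z : ℂ) := by
  rw [coeff_X_pow_mul']
  split_ifs
  · exact hQ.coeff_int _
  · exact ⟨0, by simp⟩

/-- Reduction of a power series modulo a unitriangular family of integral power series. -/
lemma exists_X_pow_dvd_sub_sum (hh : ∀ i < N, ∃ Q, Unital Q ∧ h i = X ^ i * Q)
    (hP : ∀ i < N, coeff i P ∈ S) :
    ∃ c : ℕ → ℂ, (∀ i < N, c i ∈ S) ∧ X ^ N ∣ P - ∑ i ∈ Finset.range N, C (c i) * h i := by
  induction N with
  | zero => exact ⟨0, by simp, by simp⟩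
  | succ N ih =>
    obtain ⟨c, hc, hdvd⟩ := ih (fun i hi ↦ hh i (by omega)) fun i hi ↦ hP i (by omega)
    set R := P - ∑ i ∈ Finset.range N, C (c i) * h i with hR
    refine ⟨Function.update c N (coeff N R), fun i hi ↦ ?_, ?_⟩
    · rcases eq_or_ne i N with rfl | hne
      · rw [Function.update_self, hR, map_sub, map_sum]
        refine sub_mem (hP i hi) (sum_mem fun j hj ↦ ?_)
        obtain ⟨Q, hQ, hjQ⟩ := hh j (by simp at hj; omega)
        obtain ⟨z, hz⟩ := hQ.coeff_X_pow_mul j i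
        rw [coeff_C_mul, hjQ, hz, mul_comm, ← zsmul_eq_mul]
        exact zsmul_mem (hc j (by simpa using hj)) z
      · rw [Function.update_of_ne hne]
        exact hc i (by omega)
    · rw [Finset.sum_range_succ, Function.update_self, Finset.sum_congr rfl fun i hi ↦ by
        rw [Function.update_of_ne (by simp at hi; omega)], ← sub_sub, ← hR, X_pow_dvd_iff]
      intro i hi
      obtain ⟨Q, hQ, hNQ⟩ := hh N (by omega)
      rw [map_sub, coeff_C_mul, hNQ]
      rcases Nat.lt_succ_iff_lt_or_eq.mp hi with hi | rfl
      · rw [X_pow_dvd_iff.mp hdvd i hi, coeff_X_pow_mul', if_neg (by omega)]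
        simp
      · have := coeff_X_pow_mul Q i 0
        rw [zero_add] at this
        rw [this, coeff_zero_eq_constantCoeff_apply, hQ.constantCoeff_eq]
        simp

lemma eq_zero_of_sum_eq_zero (hh : ∀ i < N, ∃ Q, Unital Q ∧ h i = X ^ i * Q) {c : ℕ → ℂ}
    (hc : ∑ i ∈ Finset.range N, C (c i) * h i = 0) : ∀ i < N, c i = 0 := by
  intro i
  induction i using Nat.strong_induction_on with
  | _ i ih =>
    intro hi
    have h1 := congrArg (coeff i) hc
    rw [map_sum, Finset.sum_eq_single i] at h1
    · obtain ⟨Q, hQ, hiQ⟩ := hh i hi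
      have := coeff_X_pow_mul Q i 0
      rw [zero_add] at this
      rw [coeff_C_mul, hiQ, this, coeff_zero_eq_constantCoeff_apply, hQ.constantCoeff_eq] at h1
      simpa using h1
    · intro j hj hne
      obtain ⟨Q, -, hjQ⟩ := hh j (by simpa using hj)
      rcases lt_or_gt_of_ne hne with hlt | hlt
      · simp [ih j hlt (by omega)]
      · rw [coeff_C_mul, hjQ, coeff_X_pow_mul', if_neg (by omega), mul_zero]
    · simp [hi]

end Triangular

section IntegralBasis

variable {p : ℕ} [NeZero p] {k D : ℕ}

/-- Integral bases of `M_k(Γ₀(p))` in echelon form. -/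
lemma exists_echelon (hp : p ∈ ({2, 3, 5} : Set ℕ)) {c : ℂ} {T : ℍ → ℂ}
    (hT : IsUnitForm p k D 0 c T) (i : ℕ) (hi : i < D + 1) :
    ∃ B : ModularForm (Gamma0 p) (k : ℤ), ∃ P : ℂ⟦X⟧,
      (∃ Q, Unital Q ∧ P = X ^ i * Q) ∧ HasQSeries B 0 P := by
  obtain ⟨f, hf⟩ := exists_isUnitForm_zero hp (i - D)
  obtain ⟨g, hg, ⟨Q, hQ, hfQ⟩, ⟨R, -, hgR⟩⟩ := (hT.mul hf).of_eq (k' := k) (a' := i)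
    (b' := D - i) (by ring) (by ring) (by ring) rfl
  have hq := hfQ.X_pow_mul i
  rw [sub_self] at hq
  obtain ⟨B, hB⟩ := hg.exists_modularForm (by rcases hp with rfl | rfl | rfl <;> norm_num)
    hq.isBoundedAtImInfty (BoundedAtFilter.mul (const_boundedAtFilter _ _)
      (hgR.isBoundedAtImInfty_of_nonneg (by omega)))
  exact ⟨B, _, ⟨Q, hQ, rfl⟩, by rwa [hB]⟩

variable {B : ℕ → ModularForm (Gamma0 p) (k : ℤ)} {h : ℕ → ℂ⟦X⟧}

lemma exists_eq_sum_echelon (hD : IsSturmBound p k D)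
    (hh : ∀ i < D + 1, ∃ Q, Unital Q ∧ h i = X ^ i * Q)
    (hB : ∀ i < D + 1, HasQSeries (B i) 0 (h i)) {S : AddSubgroup ℂ}
    (F : ModularForm (Gamma0 p) (k : ℤ)) {P : ℂ⟦X⟧}
    (hF : HasQSeries F 0 P) (hS : ∀ i < D + 1, coeff i P ∈ S) :
    ∃ c : ℕ → ℂ, (∀ i < D + 1, c i ∈ S) ∧ F = ∑ i ∈ Finset.range (D + 1), c i • B i := by
  obtain ⟨c, hc, Q, hQ⟩ := exists_X_pow_dvd_sub_sum hh hS
  refine ⟨c, hc, ?_⟩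
  have h1 := hF.sub (HasQSeries.sum (Finset.range (D + 1))
    fun i hi ↦ (hB i (by simpa using hi)).smul (c i))
  rw [hQ] at h1
  have h2 : HasQSeries (F - ∑ i ∈ Finset.range (D + 1), c i • B i :
      ModularForm (Gamma0 p) (k : ℤ)) (D + 1) Q := by
    have := h1.of_X_pow_mul
    rw [zero_add] at this
    convert! this using 2
    simp
  refine DFunLike.ext _ _ fun τ ↦ ?_
  have h3 := modularForm_eq_zero hD _ h2 τ
  exact sub_eq_zero.mp h3

lemma succ_le_finrank (hD : IsSturmBound p k D)
    (hh : ∀ i < D + 1, ∃ Q, Unital Q ∧ h i = X ^ i * Q)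
    (hB : ∀ i < D + 1, HasQSeries (B i) 0 (h i)) :
    D + 1 ≤ Module.finrank ℂ (ModularForm (Gamma0 p) (k : ℤ)) := by
  classical
  have hfin : Module.Finite ℂ (ModularForm (Gamma0 p) (k : ℤ)) := by
    refine ⟨⟨(Finset.range (D + 1)).image B, eq_top_iff.mpr fun F _ ↦ ?_⟩⟩
    obtain ⟨c, -, hc⟩ := exists_eq_sum_echelon (S := ⊤) hD hh hB F (hasQSeries_modularForm F)
      (by simp)
    rw [hc]
    exact sum_mem fun i hi ↦ Submodule.smul_mem _ _ (Submodule.subset_span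
      (Finset.mem_coe.mpr (Finset.mem_image_of_mem _ hi)))
  have hli : LinearIndependent ℂ fun i : Fin (D + 1) ↦ B i := by
    rw [Fintype.linearIndependent_iff]
    intro c hc i
    obtain ⟨c', hc'⟩ : ∃ c' : ℕ → ℂ, ∀ i : Fin (D + 1), c' i = c i :=
      ⟨fun n ↦ if hn : n < D + 1 then c ⟨n, hn⟩ else 0, fun i ↦ dif_pos i.2⟩
    have h1 := HasQSeries.sum (Finset.range (D + 1))
      fun i hi ↦ (hB i (by simpa using hi)).smul (c' i)
    have h2 : (fun τ ↦ ∑ i ∈ Finset.range (D + 1), c' i * B i τ) = fun _ ↦ 0 := by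
      ext τ
      rw [Finset.sum_range]
      simpa [hc'] using DFunLike.congr_fun hc τ
    rw [h2] at h1
    rw [← hc' i]
    exact eq_zero_of_sum_eq_zero hh h1.eq_zero i i.2
  simpa using hli.fintype_card_le_finrank

/-- If the first coefficients of a modular form lie in an additive group `S`, then so do all. -/
lemma coeff_mem_of_forall_lt (hD : IsSturmBound p k D)
    (hh : ∀ i < D + 1, ∃ Q, Unital Q ∧ h i = X ^ i * Q)
    (hB : ∀ i < D + 1, HasQSeries (B i) 0 (h i)) {S : AddSubgroup ℂ}
    (F : ModularForm (Gamma0 p) (k : ℤ)) {P : ℂ⟦X⟧}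
    (hF : HasQSeries F 0 P) (hS : ∀ i < D + 1, coeff i P ∈ S) (n : ℕ) : coeff n P ∈ S := by
  obtain ⟨c, hc, hFc⟩ := exists_eq_sum_echelon hD hh hB F hF hS
  have h1 := HasQSeries.sum (Finset.range (D + 1))
    fun i hi ↦ (hB i (by simpa using hi)).smul (c i)
  have h2 : P = ∑ i ∈ Finset.range (D + 1), C (c i) * h i := by
    refine hF.unique ?_
    convert! h1 using 1
    ext τ
    rw [hFc]
    simp
  rw [h2, map_sum]
  refine sum_mem fun i hi ↦ ?_
  rw [Finset.mem_range] at hi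
  obtain ⟨Q, hQ, hiQ⟩ := hh i hi
  obtain ⟨z, hz⟩ := hQ.coeff_X_pow_mul i n
  rw [coeff_C_mul, hiQ, hz, mul_comm, ← zsmul_eq_mul]
  exact zsmul_mem (hc i hi) z

end IntegralBasis

/-- The `q`-series of a weakly holomorphic form with pole of order at most `M`. -/
lemma WhmForm.hasQSeries {Γ : Subgroup SL(2, ℤ)} {k : ℤ} (f : WhmForm Γ k) {M : ℤ}
    (hM : ∀ n < -M, f.coeff n = 0) :
    HasQSeries f.toFun (-M) (PowerSeries.mk fun n ↦ f.coeff (n - M)) := by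
  intro τ
  have h1 := (f.expansion.2 τ).mul_left (qexp τ ^ M)
  have hinj : Function.Injective fun n : ℕ ↦ (n : ℤ) - M := fun x y hxy ↦ by simpa using hxy
  rw [← hinj.hasSum_iff] at h1
  · refine h1.congr_left_right (fun n ↦ ?_) (by simp)
    rw [coeff_mk, Function.comp_apply, zpow_sub₀ (qexp_ne_zero τ), zpow_natCast]
    have := zpow_ne_zero M (qexp_ne_zero τ)
    field_simp
  · intro n hn
    rw [hM n, zero_mul, mul_zero]
    by_contra! h
    exact hn ⟨(n + M).toNat, by simp; omega⟩

/-- The series of `q^M * (q^(-M) + O(q))`. -/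
lemma coeff_mk_of_isBasisElt {k : ℤ} {M : ℕ} {f : WhmForm ⊤ k} (hf : IsBasisElt k 0 M f) {n : ℕ}
    (hn : n ≤ M) :
    coeff n (PowerSeries.mk fun n : ℕ ↦ f.coeff (n - M)) = if n = 0 then 1 else 0 := by
  rw [coeff_mk]
  split_ifs with h
  · rw [h, Nat.cast_zero, zero_sub, hf.1]
  · exact hf.2 _ (by omega) (by omega)

lemma WhmForm.smul_eq {k : ℤ} (f : WhmForm ⊤ k) (γ : SL(2, ℤ)) (τ : ℍ) :
    f.toFun (γ • τ) = denom γ τ ^ k * f.toFun τ := by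
  have h : γ ∈ slashStabilizer k f.toFun := f.slash_eq γ trivial
  exact mem_slashStabilizer.mp h τ

section Comparison

variable {p : ℕ} [NeZero p] {k : ℕ}

lemma isFrickePair_sub_comp_scale {k : ℤ} (f₁ f₂ : WhmForm ⊤ k) :
    IsFrickePair p k (fun τ ↦ f₁.toFun τ - f₂.toFun (scale p τ))
      (fun τ ↦ (p : ℂ) ^ k * f₁.toFun (scale p τ) - f₂.toFun τ) where
  holo := by
    have h1 := f₁.holo
    have h2 := mdifferentiable_comp_scale p f₂.holo
    rw [UpperHalfPlane.mdifferentiable_iff] at h1 h2 ⊢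
    exact h1.sub h2
  le_stabilizer := by
    intro γ hγ
    obtain ⟨γ', -, hγ'⟩ := exists_scale_smul hγ
    refine mem_slashStabilizer.mpr fun τ ↦ ?_
    simp only [(hγ' τ).1, WhmForm.smul_eq, (hγ' τ).2]
    ring
  fricke_eq τ := by
    rw [scale_fricke, neginv_eq, fricke_eq_smul, WhmForm.smul_eq, WhmForm.smul_eq,
      ModularGroup.denom_S, ModularGroup.denom_S, coe_scale, mul_zpow]
    ring

/-- Forms with prescribed pole at the cusp `0` and coefficients at `∞` divisible by `p^ε`. -/
lemma exists_isFrickePair_pole (hp : p ∈ ({2, 3, 5} : Set ℕ)) {D : ℕ} {c : ℤ} (hc : c ≠ 0)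
    {T : ℍ → ℂ} (hT : IsUnitForm p k D 0 (c : ℂ)⁻¹ T) {ε : ℕ} (hε : ε < 12 / (p - 1)) {j : ℕ}
    (hj : 0 < j) : ∃ (E u : ℍ → ℂ) (R Q : ℂ⟦X⟧), IsFrickePair p k E u ∧ HasQSeries E 0 R ∧
      (∀ n, coeff n R ∈ AddSubgroup.zmultiples ((p : ℂ) ^ ε)) ∧
      HasQSeries u (-j) Q ∧ Unital Q := by
  obtain ⟨f, hf⟩ := exists_isUnitForm_zero hp j
  obtain ⟨u, hu, ⟨P, hP, hfP⟩, ⟨Q, hQ, hgQ⟩⟩ := (hT.mul hf).of_eq (k' := k) (a' := (D + j : ℕ))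
    (b' := -j) (by ring) (by push_cast; ring) (by ring) rfl
  have hp0 : (p : ℂ) ≠ 0 := NeZero.ne _
  have hc0 : (c : ℂ) ≠ 0 := by exact_mod_cast hc
  set N : ℂ := (p : ℂ) ^ (12 / (p - 1) : ℕ) with hN
  have hN0 : N ≠ 0 := pow_ne_zero _ hp0
  have hq := (hfP.X_pow_mul (D + j)).smul (c * N ^ j)
  rw [sub_self] at hq
  have hu' := hu.smul (c * N ^ j)
  refine ⟨_, u, _, Q, ?_, hq, fun n ↦ ?_, hgQ, hQ⟩
  · convert! hu' using 1
    ext τ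
    rw [zpow_neg, zpow_natCast]
    field_simp
  · obtain ⟨z, hz⟩ := hP.coeff_X_pow_mul (D + j) n
    obtain ⟨j, rfl⟩ := Nat.exists_eq_add_of_lt hj
    obtain ⟨t, ht⟩ := Nat.exists_eq_add_of_lt hε
    refine AddSubgroup.mem_zmultiples_iff.mpr
      ⟨c * z * p ^ (t + 1) * ((p : ℤ) ^ (12 / (p - 1) : ℕ)) ^ j, ?_⟩
    have hN' : N = (p : ℂ) ^ ε * (p : ℂ) ^ (t + 1) := by rw [hN, ht, ← pow_add]; rfl
    rw [coeff_C_mul, hz, zsmul_eq_mul]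
    push_cast
    rw [← hN, zero_add, pow_succ, hN']
    ring

end Comparison

section Main

variable {p : ℕ} [NeZero p] {k : ℕ}

/-- If `g` has integral principal part at the cusp `0`, is holomorphic at `∞`, and its first
coefficients are divisible by `p^ε`, then so are all of them. -/
lemma coeff_mem_zmultiples_of_isFrickePair (hp : p ∈ ({2, 3, 5} : Set ℕ))
    (hk : k ∈ ({4, 6, 8, 10, 14} : Set ℕ)) {ε : ℕ} (hε : ε < 12 / (p - 1)) {f g : ℍ → ℂ}
    (h : IsFrickePair p k f g) {P R : ℂ⟦X⟧} (hf : HasQSeries f 0 P) {J : ℕ}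
    (hg : HasQSeries g (-J) R) (hR : ∀ i < J, coeff i R ∈ AddSubgroup.zmultiples (1 : ℂ))
    (hP : ∀ i < Module.finrank ℂ (ModularForm (Gamma0 p) (k : ℤ)),
      coeff i P ∈ AddSubgroup.zmultiples ((p : ℂ) ^ ε)) (n : ℕ) :
    coeff n P ∈ AddSubgroup.zmultiples ((p : ℂ) ^ ε) := by
  have hp' : p.Prime := by rcases hp with rfl | rfl | rfl <;> norm_num
  obtain ⟨D, c, T, hD, hc, hT⟩ := exists_isUnitForm hp hk
  have hex (j : ℕ) : ∃ (E u : ℍ → ℂ) (R Q : ℂ⟦X⟧), 0 < j → IsFrickePair p k E u ∧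
      HasQSeries E 0 R ∧ (∀ n, coeff n R ∈ AddSubgroup.zmultiples ((p : ℂ) ^ ε)) ∧
      HasQSeries u (-j) Q ∧ Unital Q := by
    rcases Nat.eq_zero_or_pos j with rfl | hj
    · exact ⟨0, 0, 0, 0, by simp⟩
    · obtain ⟨E, u, R, Q, h⟩ := exists_isFrickePair_pole hp hc hT hε hj
      exact ⟨E, u, R, Q, fun _ ↦ h⟩
  choose E u V Q hE using hex
  have hexB (i : ℕ) : ∃ (B : ModularForm (Gamma0 p) (k : ℤ)) (P : ℂ⟦X⟧), i < D + 1 →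
      (∃ Q, Unital Q ∧ P = X ^ i * Q) ∧ HasQSeries B 0 P := by
    by_cases hi : i < D + 1
    · obtain ⟨B, P, h⟩ := exists_echelon hp hT i hi
      exact ⟨B, P, fun _ ↦ h⟩
    · exact ⟨0, 0, fun h ↦ absurd h hi⟩
  choose B W hBW using hexB
  have hh := fun i hi ↦ (hBW i hi).1
  have hB := fun i hi ↦ (hBW i hi).2
  obtain ⟨b, hb, Z, hZ⟩ := exists_X_pow_dvd_sub_sum (N := J) (h := fun i ↦ X ^ i * Q (J - i))
    (fun i hi ↦ ⟨_, (hE (J - i) (by omega)).2.2.2.2, rfl⟩) hR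
  have hpair := h.sub (IsFrickePair.sum (Finset.range J) fun i hi ↦
    (hE (J - i) (by simp at hi; omega)).1.smul (b i))
  have hF := hf.sub (HasQSeries.sum (Finset.range J) fun i hi ↦
    (hE (J - i) (by simp at hi; omega)).2.1.smul (b i))
  have hG := hg.sub (HasQSeries.sum (Finset.range J) fun i hi ↦ by
    have hi' : i < J := by simpa using hi
    have := ((hE (J - i) (by omega)).2.2.2.1.X_pow_mul i).smul (b i)
    rwa [show (-(J - i : ℕ) - i : ℤ) = -J by omega] at this)
  rw [hZ] at hG
  have hG' := hG.of_X_pow_mul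
  rw [neg_add_cancel] at hG'
  obtain ⟨F, hFF⟩ := hpair.exists_modularForm hp' hF.isBoundedAtImInfty hG'.isBoundedAtImInfty
  rw [← hFF] at hF
  have hsum (i : ℕ) : coeff i (∑ i ∈ Finset.range J, C (b i) * V (J - i)) ∈
      AddSubgroup.zmultiples ((p : ℂ) ^ ε) := by
    rw [map_sum]
    refine sum_mem fun j hj ↦ ?_
    have hj' : j < J := by simpa using hj
    obtain ⟨z, hz⟩ := AddSubgroup.mem_zmultiples_iff.mp (hb j hj')
    rw [coeff_C_mul, ← hz, smul_mul_assoc, one_mul]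
    exact zsmul_mem ((hE (J - j) (by omega)).2.2.1 i) z
  have key := coeff_mem_of_forall_lt hD hh hB F hF (S := AddSubgroup.zmultiples ((p : ℂ) ^ ε))
    (fun i hi ↦ by
      rw [map_sub]
      exact sub_mem (hP i (hi.trans_le (succ_le_finrank hD hh hB))) (hsum i)) n
  rw [map_sub] at key
  simpa using add_mem key (hsum n)

end Main

/-- If the coefficients `γ_n` of `g = f_{k,mpˢ}(τ) - f_{k,mp^{s-1}}(pτ)` with
`1 ≤ n ≤ d-1` are divisible by `p^ε` (`ε < 12/(p-1)`), then all of them are; in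
particular `p^ε ∣ a_k(mpˢ, n) = γ_n` for `p ∤ n`. -/
theorem stmt_17 (p : ℕ) (hp : p ∈ ({2, 3, 5} : Set ℕ)) (k : ℕ)
    (hk : k ∈ ({4, 6, 8, 10, 14} : Set ℕ)) (m : ℤ) (hm : 0 < m) (s : ℕ) (hs : 0 < s)
    (d : ℕ) (hd : d = Module.finrank ℂ (ModularForm (Gamma0 p) (k : ℤ)))
    (f1 f2 : WhmForm ⊤ (k : ℤ))
    (hf1 : IsBasisElt k 0 (m * p ^ s) f1)
    (hf2 : IsBasisElt k 0 (m * p ^ (s - 1)) f2)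
    (γ : ℕ → ℤ)
    (hγ : ∀ n : ℕ, 0 < n →
      f1.coeff n - (if (p : ℤ) ∣ (n : ℤ) then f2.coeff ((n : ℤ) / p) else 0) = (γ n : ℂ))
    (ε : ℕ) (hε : ε < 12 / (p - 1))
    (hsmall : ∀ n : ℕ, 1 ≤ n → n ≤ d - 1 → (p : ℤ) ^ ε ∣ γ n) :
    (∀ n : ℕ, 1 ≤ n → (p : ℤ) ^ ε ∣ γ n) ∧
    ∀ n : ℕ, 0 < n → ¬ p ∣ n → f1.coeff n = (γ n : ℂ) ∧ (p : ℤ) ^ ε ∣ γ n := by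
  suffices hall : ∀ n : ℕ, 1 ≤ n → (p : ℤ) ^ ε ∣ γ n by
    refine ⟨hall, fun n hn hpn ↦ ⟨?_, hall n hn⟩⟩
    rw [← hγ n hn, if_neg (by exact_mod_cast hpn), sub_zero]
  have hp0 : 0 < p := by rcases hp with rfl | rfl | rfl <;> norm_num
  have : NeZero p := ⟨hp0.ne'⟩
  obtain ⟨s, rfl⟩ := Nat.exists_eq_add_of_lt hs
  lift m to ℕ using hm.le
  obtain ⟨M, hM⟩ : ∃ M : ℕ, M = m * p ^ s := ⟨_, rfl⟩
  have e1 : (m : ℤ) * p ^ (0 + s + 1) = (p * M : ℕ) := by rw [hM]; push_cast; ring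
  have e2 : (m : ℤ) * p ^ (0 + s + 1 - 1) = (M : ℕ) := by rw [hM]; simp
  rw [e1] at hf1
  rw [e2] at hf2
  have hM0 : 0 < M := by
    rw [hM]
    exact Nat.mul_pos (by exact_mod_cast hm) (pow_pos hp0 s)
  have hpM : M ≤ p * M := Nat.le_mul_of_pos_left _ hp0
  have h1 := f1.hasQSeries (M := (p * M : ℕ)) fun n hn ↦ hf1.2 n hn.ne (by omega)
  have h2 := f2.hasQSeries (M := (M : ℕ)) fun n hn ↦ hf2.2 n hn.ne (by omega)
  have c1 := fun n hn ↦ coeff_mk_of_isBasisElt hf1 (n := n) hn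
  have c2 := fun n hn ↦ coeff_mk_of_isBasisElt hf2 (n := n) hn
  set P₁ : ℂ⟦X⟧ := PowerSeries.mk fun n ↦ f1.coeff (n - (p * M : ℕ)) with hP₁
  set P₂ : ℂ⟦X⟧ := PowerSeries.mk fun n ↦ f2.coeff (n - (M : ℕ)) with hP₂
  have hexp (P : ℂ⟦X⟧) (n : ℕ) : coeff n (expand p hp0.ne' P) =
      if p ∣ n then coeff (n / p) P else 0 := by
    split_ifs with h
    · obtain ⟨j, rfl⟩ := h
      rw [coeff_expand_mul, Nat.mul_div_cancel_left _ hp0]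
    · exact coeff_expand_of_not_dvd _ _ _ h
  have hvanish (n : ℕ) (hn : n ≤ p * M) : coeff n (P₁ - expand p hp0.ne' P₂) = 0 := by
    rw [map_sub, c1 n hn, hexp]
    by_cases h : p ∣ n
    · obtain ⟨j, rfl⟩ := h
      have hj : j ≤ M := Nat.le_of_mul_le_mul_left hn hp0
      simp [Nat.mul_div_cancel_left _ hp0, c2 j hj, hp0.ne']
    · have : n ≠ 0 := by rintro rfl; simp at h
      simp [h, this]
  obtain ⟨P, hP⟩ : X ^ (p * M) ∣ P₁ - expand p hp0.ne' P₂ :=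
    X_pow_dvd_iff.mpr fun n hn ↦ hvanish n hn.le
  have h1' := h1.comp_scale (p := p)
  have h2' := h2.comp_scale (p := p)
  rw [show (p : ℤ) * -(M : ℕ) = -(p * M : ℕ) by push_cast; ring] at h2'
  have hf := h1.sub h2'
  rw [hP] at hf
  have hf := hf.of_X_pow_mul
  rw [neg_add_cancel] at hf
  have h1'' := h1'.smul ((p : ℂ) ^ (k : ℤ))
  rw [show (p : ℤ) * -(p * M : ℕ) = -(p * (p * M) : ℕ) by push_cast; ring] at h1''
  have hpM' : p * M ≤ p * (p * M) := Nat.le_mul_of_pos_left _ hp0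
  have h2'' := h2.X_pow_mul (p * (p * M) - M)
  rw [show (-(M : ℕ) - (p * (p * M) - M : ℕ) : ℤ) = -(p * (p * M) : ℕ) by omega] at h2''
  have hcoeff (n : ℕ) : coeff n P = coeff (n + p * M) (P₁ - expand p hp0.ne' P₂) := by
    rw [hP, coeff_X_pow_mul]
  have hcoeff_pos (n : ℕ) (hn : 0 < n) : coeff n P = (γ n : ℂ) := by
    rw [hcoeff, ← hγ n hn, map_sub, hP₁, coeff_mk, hexp]
    simp only [Nat.dvd_add_left (dvd_mul_right p M)]
    congr 1
    · simp
    · by_cases h : p ∣ n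
      · rw [if_pos h, if_pos (by exact_mod_cast h), Nat.add_mul_div_left _ _ hp0, hP₂, coeff_mk]
        simp
      · rw [if_neg h, if_neg (by exact_mod_cast h)]
  have key := coeff_mem_zmultiples_of_isFrickePair hp hk hε (isFrickePair_sub_comp_scale f1 f2)
    hf (h1''.sub h2'') (fun i hi ↦ ?_) (fun i hi ↦ ?_)
  · intro n hn
    obtain ⟨z, hz⟩ := AddSubgroup.mem_zmultiples_iff.mp (key n)
    rw [hcoeff_pos n hn, zsmul_eq_mul] at hz
    exact ⟨z, by rw [mul_comm]; exact_mod_cast hz.symm⟩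
  · have hone : (1 : ℂ) ∈ AddSubgroup.zmultiples (1 : ℂ) := AddSubgroup.mem_zmultiples 1
    rw [map_sub, coeff_C_mul, hexp, coeff_X_pow_mul']
    refine sub_mem ?_ ?_
    · split_ifs with h
      · rw [c1 _ (Nat.div_lt_of_lt_mul hi).le]
        refine AddSubgroup.mem_zmultiples_iff.mpr ⟨p ^ k * if i / p = 0 then 1 else 0, ?_⟩
        rw [zsmul_eq_mul]
        push_cast
        simp
      · simp
    · split_ifs with h
      · rw [c2 _ (by omega)]
        split_ifs
        exacts [hone, zero_mem _]
      · exact zero_mem _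
  · rcases Nat.eq_zero_or_pos i with rfl | hi0
    · rw [hcoeff, hvanish _ (by omega)]
      exact zero_mem _
    · obtain ⟨z, hz⟩ := hsmall i hi0 (by omega)
      rw [hcoeff_pos i hi0, hz]
      exact AddSubgroup.mem_zmultiples_iff.mpr ⟨z, by push_cast; rw [zsmul_eq_mul, mul_comm]⟩
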